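/- arXiv:1104.3553 — 3 statements merged into one kernel-verified Lean document; each statement's English description precedes it below -/
import Mathlib

section
/- There exists a constant C > 0 such that for every complex Hilbert space H and all bounded linear operators S, T on H with S ≠ T, one has ‖ |S| − |T| ‖ ≤ C · ‖S − T‖ · log(2 + log((‖S‖ + ‖T‖)/‖S − T‖)). -/
open MeasureTheory ENNReal

/-- `|T| = (T*T)^{1/2}` via the continuous functional calculus. -/
noncomputable def opAbs {H : Type} [NormedAddCommGroup H] [InnerProductSpace ℂ H]
    [CompleteSpace H] (T : H →L[ℂ] H) : H →L[ℂ] H :=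
  cfc Real.sqrt (star T * T)

/-- The Hilbert space `ℓ²(ℕ, ℂ)`. -/
noncomputable abbrev ellTwo : Type := lp (fun _ : ℕ => ℂ) 2

open ComplexConjugate
open scoped NNReal

section Sylvester

variable {H K : Type*} [NormedAddCommGroup H] [InnerProductSpace ℂ H] [CompleteSpace H]
  [NormedAddCommGroup K] [InnerProductSpace ℂ K] [CompleteSpace K]

/-- An arithmetic-geometric mean inequality for operators, with a phase. -/
lemma two_re_mul_norm_comp_le (x : K →L[ℂ] K) (y : H →L[ℂ] H)
    (hx : IsSelfAdjoint x) (hy : IsSelfAdjoint y)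
    (hx1 : ∀ k, ‖k‖ ≤ ‖x k‖) (hy1 : ∀ h, ‖h‖ ≤ ‖y h‖)
    (X : H →L[ℂ] K) (u : ℂ) (hu : 0 < u.re) :
    2 * u.re * ‖x ∘L X ∘L y‖ ≤ ‖u • (x ∘L x ∘L X) + conj u • (X ∘L y ∘L y)‖ := by
  set W := x ∘L X ∘L y with hW
  set Y := u • (x ∘L x ∘L X) + conj u • (X ∘L y ∘L y) with hY
  set s := ‖W‖ with hs
  by_contra! hlt
  have hs0 : 0 < s := by
    by_contra! h0
    have : s = 0 := le_antisymm h0 (norm_nonneg _)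
    rw [this] at hlt
    linarith [norm_nonneg Y]
  have hxs : ∀ p q, inner ℂ (x p) q = inner ℂ p (x q) := fun p q => hx.isSymmetric p q
  have hys : ∀ p q, inner ℂ (y p) q = inner ℂ p (y q) := fun p q => hy.isSymmetric p q
  have key : ∀ r, 0 < r → r < s →
      (2 * u.re * s - ‖Y‖) * r ^ 2 ≤ ‖y‖ ^ 2 * ‖u‖ * s ^ 2 * √(s ^ 2 - r ^ 2) := by
    intro r hr0 hrs
    obtain ⟨ξ, hξ1, hξ⟩ := W.exists_lt_apply_of_lt_opNorm hrs
    set η := W ξ with hη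
    set e := W.adjoint η - ((s ^ 2 : ℝ) : ℂ) • ξ with he
    have hηs : ‖η‖ ≤ s * ‖ξ‖ := W.le_opNorm ξ
    have he2 : ‖e‖ ^ 2 ≤ s ^ 2 * (s ^ 2 - r ^ 2) := by
      have h1 : ‖W.adjoint η‖ ≤ s * ‖η‖ := by
        simpa [hs] using W.adjoint.le_opNorm η
      have h2 : RCLike.re (inner ℂ (W.adjoint η) (((s ^ 2 : ℝ) : ℂ) • ξ)) = s ^ 2 * ‖η‖ ^ 2 := by
        rw [inner_smul_right, ContinuousLinearMap.adjoint_inner_left, ← hη,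
          inner_self_eq_norm_sq_to_K]
        simp [← Complex.ofReal_pow]
      rw [he, @norm_sub_sq ℂ, h2, norm_smul]
      have h3 : ‖((s ^ 2 : ℝ) : ℂ)‖ = s ^ 2 := by
        rw [Complex.norm_real, Real.norm_of_nonneg (by positivity)]
      rw [h3]
      have h4 : ‖W.adjoint η‖ ^ 2 ≤ s ^ 2 * ‖η‖ ^ 2 := by
        rw [← mul_pow]; gcongr
      have h5 : ‖ξ‖ ^ 2 ≤ 1 := pow_le_one₀ (norm_nonneg _) hξ1.le
      have h6 : r ^ 2 ≤ ‖η‖ ^ 2 := by gcongr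
      have h7 : s ^ 2 * r ^ 2 ≤ s ^ 2 * ‖η‖ ^ 2 := by gcongr
      have h8 : s ^ 2 * s ^ 2 * ‖ξ‖ ^ 2 ≤ s ^ 2 * s ^ 2 * 1 := by gcongr
      nlinarith
    have he3 : ‖e‖ ≤ s * √(s ^ 2 - r ^ 2) := by
      rw [← Real.sqrt_sq hs0.le, ← Real.sqrt_mul (by positivity), Real.sq_sqrt (by positivity)]
      exact Real.le_sqrt_of_sq_le he2
    have hinner : inner ℂ (x η) (Y (y ξ)) =
        u * (‖x η‖ ^ 2 : ℝ) + conj u * ((s ^ 2 * ‖y ξ‖ ^ 2 : ℝ) + inner ℂ e (y (y ξ))) := by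
      have e1 : inner ℂ (x η) (X (y (y (y ξ)))) =
          ((s ^ 2 * ‖y ξ‖ ^ 2 : ℝ) : ℂ) + inner ℂ e (y (y ξ)) := by
        have : inner ℂ (x η) (X (y (y (y ξ)))) = inner ℂ (W.adjoint η) (y (y ξ)) := by
          rw [ContinuousLinearMap.adjoint_inner_left, hxs]; rfl
        rw [this, he, inner_sub_left, inner_smul_left, ← hys ξ (y ξ),
          inner_self_eq_norm_sq_to_K]
        simp
      have e2 : inner ℂ (x η) (x (x (X (y ξ)))) = ((‖x η‖ ^ 2 : ℝ) : ℂ) := by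
        have : x (x (X (y ξ))) = x η := rfl
        rw [this, inner_self_eq_norm_sq_to_K]
        simp
      rw [← e1, ← e2, hY]
      simp
    have hle : ‖inner ℂ (x η) (Y (y ξ))‖ ≤ ‖x η‖ * (‖Y‖ * ‖y ξ‖) :=
      (norm_inner_le_norm _ _).trans (by gcongr; exact Y.le_opNorm _)
    have hre := (Complex.re_le_norm _).trans hle
    rw [hinner] at hre
    have herr : ‖conj u * inner ℂ e (y (y ξ))‖ ≤ ‖y‖ ^ 2 * ‖u‖ * (s * √(s ^ 2 - r ^ 2)) := by
      have h1 : ‖y (y ξ)‖ ≤ ‖y‖ ^ 2 := by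
        calc ‖y (y ξ)‖ ≤ ‖y‖ * (‖y‖ * ‖ξ‖) :=
              (y.le_opNorm _).trans (by gcongr; exact y.le_opNorm _)
          _ ≤ ‖y‖ * (‖y‖ * 1) := by gcongr
          _ = ‖y‖ ^ 2 := by ring
      rw [norm_mul, RCLike.norm_conj]
      calc ‖u‖ * ‖inner ℂ e (y (y ξ))‖ ≤ ‖u‖ * (‖e‖ * ‖y (y ξ)‖) := by
            gcongr; exact norm_inner_le_norm _ _
        _ ≤ ‖u‖ * ((s * √(s ^ 2 - r ^ 2)) * ‖y‖ ^ 2) := by gcongr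
        _ = _ := by ring
    have herr' := (abs_le.1 ((Complex.abs_re_le_norm _).trans herr)).1
    have hexp : (u * (‖x η‖ ^ 2 : ℝ) +
        conj u * ((s ^ 2 * ‖y ξ‖ ^ 2 : ℝ) + inner ℂ e (y (y ξ)))).re =
        u.re * (‖x η‖ ^ 2 + s ^ 2 * ‖y ξ‖ ^ 2) + (conj u * inner ℂ e (y (y ξ))).re := by
      rw [mul_add, Complex.add_re, Complex.add_re, Complex.re_mul_ofReal, Complex.re_mul_ofReal,
        Complex.conj_re]
      ring
    rw [hexp] at hre
    have hpq : r ^ 2 ≤ s * (‖x η‖ * ‖y ξ‖) := by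
      have h1 : r ≤ ‖x η‖ := hξ.le.trans (hx1 η)
      have h2 : r ≤ s * ‖y ξ‖ := hξ.le.trans (hηs.trans (by gcongr; exact hy1 ξ))
      calc r ^ 2 = r * r := by ring
        _ ≤ ‖x η‖ * (s * ‖y ξ‖) := by gcongr
        _ = _ := by ring
    have hamgm : u.re * (2 * s * (‖x η‖ * ‖y ξ‖)) ≤ u.re * (‖x η‖ ^ 2 + s ^ 2 * ‖y ξ‖ ^ 2) := by
      gcongr
      nlinarith [sq_nonneg (‖x η‖ - s * ‖y ξ‖)]
    have hmain : (2 * u.re * s - ‖Y‖) * (‖x η‖ * ‖y ξ‖) ≤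
        ‖y‖ ^ 2 * ‖u‖ * (s * √(s ^ 2 - r ^ 2)) := by linarith
    calc (2 * u.re * s - ‖Y‖) * r ^ 2 ≤ (2 * u.re * s - ‖Y‖) * (s * (‖x η‖ * ‖y ξ‖)) := by
          gcongr
      _ = s * ((2 * u.re * s - ‖Y‖) * (‖x η‖ * ‖y ξ‖)) := by ring
      _ ≤ s * (‖y‖ ^ 2 * ‖u‖ * (s * √(s ^ 2 - r ^ 2))) := by gcongr
      _ = _ := by ring
  have hlim : (2 * u.re * s - ‖Y‖) * s ^ 2 ≤ ‖y‖ ^ 2 * ‖u‖ * s ^ 2 * √(s ^ 2 - s ^ 2) := by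
    refine le_of_tendsto_of_tendsto (b := nhdsWithin s (Set.Iio s))
      (f := fun r => (2 * u.re * s - ‖Y‖) * r ^ 2)
      (g := fun r => ‖y‖ ^ 2 * ‖u‖ * s ^ 2 * √(s ^ 2 - r ^ 2)) ?_ ?_ ?_
    · exact (Continuous.tendsto (by fun_prop) s).mono_left nhdsWithin_le_nhds
    · exact (Continuous.tendsto (by fun_prop) s).mono_left nhdsWithin_le_nhds
    · filter_upwards [Ioo_mem_nhdsLT hs0] with r hr using key r hr.1 hr.2
  rw [sub_self, Real.sqrt_zero, mul_zero] at hlim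
  nlinarith [mul_pos (sub_pos.2 hlt) (pow_pos hs0 2)]

/-- Tripling step: a bound for the Sylvester-type quotient at `x ^ 2`, `y ^ 2` gives one at
`x ^ 6`, `y ^ 6`, at the cost of an absolute additive constant. -/
lemma norm_sub_le_norm_add_of_sq (x : K →L[ℂ] K) (y : H →L[ℂ] H)
    (hx : IsSelfAdjoint x) (hy : IsSelfAdjoint y)
    (hx1 : ∀ k, ‖k‖ ≤ ‖x k‖) (hy1 : ∀ h, ‖h‖ ≤ ‖y h‖) (F : ℝ)
    (hF : ∀ Z : H →L[ℂ] K, ‖(x ^ 2) ∘L Z - Z ∘L (y ^ 2)‖ ≤ F * ‖(x ^ 2) ∘L Z + Z ∘L (y ^ 2)‖)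
    (Z : H →L[ℂ] K) :
    ‖(x ^ 6) ∘L Z - Z ∘L (y ^ 6)‖ ≤ (F + 2) * ‖(x ^ 6) ∘L Z + Z ∘L (y ^ 6)‖ := by
  set Y := (x ^ 6) ∘L Z + Z ∘L (y ^ 6) with hY
  have hsq3 : (0 : ℝ) ≤ √3 := Real.sqrt_nonneg 3
  have hsq3' : √3 * √3 = 3 := Real.mul_self_sqrt (by norm_num)
  let ω : ℂ := ⟨1 / 2, √3 / 2⟩
  have hωre : ω.re = 1 / 2 := rfl
  have hωsq : ω * ω = ω - 1 := by
    apply Complex.ext <;> simp [ω] <;> nlinarith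
  have hωc : conj ω = 1 - ω := by
    apply Complex.ext <;> simp [ω]; norm_num
  have hωn : ‖ω‖ = 1 := by
    have : ‖ω‖ ^ 2 = 1 := by
      rw [← Complex.normSq_eq_norm_sq, Complex.normSq_apply]; simp [ω]; nlinarith
    nlinarith [norm_nonneg ω]
  have hωd : 1 ≤ ‖ω - conj ω‖ := by
    have : ‖ω - conj ω‖ ^ 2 = 3 := by
      rw [← Complex.normSq_eq_norm_sq, Complex.normSq_apply]; simp [ω]
    nlinarith [norm_nonneg (ω - conj ω)]
  set G := (x ^ 4) ∘L Z - (x ^ 2) ∘L Z ∘L (y ^ 2) + Z ∘L (y ^ 4) with hG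
  have hYG : Y = (x ^ 2) ∘L G + G ∘L (y ^ 2) := by
    ext v; simp [hY, hG, pow_succ]; abel
  have hV : 2 * ‖x ∘L G ∘L y‖ ≤ ‖Y‖ := by
    have := two_re_mul_norm_comp_le x y hx hy hx1 hy1 G 1 (by simp)
    have h2 : Y = (1 : ℂ) • (x ∘L x ∘L G) + conj (1 : ℂ) • (G ∘L y ∘L y) := by
      rw [hYG]; ext v; simp [pow_succ]
    rw [← h2] at this
    simpa using this
  set Z' := x ∘L Z ∘L y with hZ'
  have hA : ∀ θ : ℂ, θ * θ = θ - 1 → conj θ = 1 - θ → ‖θ‖ = 1 → θ.re = 1 / 2 →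
      ‖x ∘L ((x ^ 2) ∘L Z' - θ • (Z' ∘L (y ^ 2))) ∘L y‖ ≤ ‖x ∘L G ∘L y‖ := by
    intro θ h1 h2 h3 h4
    have := two_re_mul_norm_comp_le x y hx hy hx1 hy1
      ((x ^ 2) ∘L Z' - θ • (Z' ∘L (y ^ 2))) (conj θ) (by simp [h4])
    have h5 : conj θ • (x ∘L x ∘L ((x ^ 2) ∘L Z' - θ • (Z' ∘L (y ^ 2)))) +
        conj (conj θ) • (((x ^ 2) ∘L Z' - θ • (Z' ∘L (y ^ 2))) ∘L y ∘L y) =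
        conj θ • (x ∘L G ∘L y) := by
      rw [RCLike.conj_conj, h2]
      ext v
      simp only [hZ', hG, pow_succ, pow_zero, one_mul, ContinuousLinearMap.comp_apply,
        mul_apply_eq_comp, add_apply, sub_apply,
        smul_apply, map_add, map_sub, map_smul, smul_sub, smul_add, smul_smul,
        sub_mul, h1]
      module
    rw [h5, norm_smul, RCLike.norm_conj, h3, Complex.conj_re, h4] at this
    linarith
  have hA1 := hA ω hωsq hωc hωn hωre
  have hA2 := hA (conj ω) (by rw [hωc]; linear_combination hωsq) (by rw [RCLike.conj_conj, hωc]; ring)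
    (by rw [RCLike.norm_conj, hωn]) (by simp [hωre])
  set W₁ := x ∘L ((x ^ 2) ∘L Z' - ω • (Z' ∘L (y ^ 2))) ∘L y with hW1
  set W₂ := x ∘L ((x ^ 2) ∘L Z' - conj ω • (Z' ∘L (y ^ 2))) ∘L y with hW2
  set Q := (x ^ 4) ∘L Z ∘L (y ^ 2) - (x ^ 2) ∘L Z ∘L (y ^ 4) with hQ
  have hQW : (ω - conj ω) • Q = ω • W₁ - conj ω • W₂ := by
    rw [hW1, hW2, hωc]
    ext v
    simp only [hZ', hQ, pow_succ, pow_zero, one_mul, ContinuousLinearMap.comp_apply,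
      mul_apply_eq_comp, sub_apply, smul_apply, map_sub, map_smul, smul_sub, smul_smul,
      sub_mul, mul_sub, hωsq]
    module
  have hQn : ‖Q‖ ≤ ‖Y‖ := by
    calc ‖Q‖ ≤ ‖ω - conj ω‖ * ‖Q‖ := le_mul_of_one_le_left (norm_nonneg _) hωd
      _ = ‖ω • W₁ - conj ω • W₂‖ := by rw [← norm_smul, hQW]
      _ ≤ ‖W₁‖ + ‖W₂‖ := by
        refine (norm_sub_le _ _).trans ?_
        rw [norm_smul, norm_smul, RCLike.norm_conj, hωn, one_mul, one_mul]
      _ ≤ ‖Y‖ := by linarith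
  have hfin : (x ^ 6) ∘L Z - Z ∘L (y ^ 6) = ((x ^ 2) ∘L G - G ∘L (y ^ 2)) + (2 : ℂ) • Q := by
    ext v
    simp only [hG, hQ, pow_succ, pow_zero, one_mul, ContinuousLinearMap.comp_apply,
      mul_apply_eq_comp, add_apply, sub_apply, smul_apply, map_add, map_sub]
    module
  rw [hfin]
  refine (norm_add_le _ _).trans ?_
  have := hF G
  rw [← hYG] at this
  rw [norm_smul]
  simp only [Complex.norm_ofNat]
  linarith

lemma algebraMap_le_iff_forall_re_inner {a : H →L[ℂ] H} (ha : IsSelfAdjoint a) (r : ℝ) :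
    algebraMap ℝ (H →L[ℂ] H) r ≤ a ↔ ∀ h, r * ‖h‖ ^ 2 ≤ (inner ℂ (a h) h).re := by
  have hr : IsSelfAdjoint (algebraMap ℝ (H →L[ℂ] H) r) := IsSelfAdjoint.algebraMap _ (.all r)
  rw [ContinuousLinearMap.le_def, ContinuousLinearMap.isPositive_def',
    and_iff_right (ha.sub hr)]
  refine forall_congr' fun h => ?_
  rw [ContinuousLinearMap.reApplyInnerSelf_apply, sub_apply, inner_sub_left, map_sub, sub_nonneg]
  have : algebraMap ℝ (H →L[ℂ] H) r h = (r : ℂ) • h := by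
    simp [Algebra.algebraMap_eq_smul_one]
  rw [this, inner_smul_left, inner_self_eq_norm_sq_to_K]
  simp [← Complex.ofReal_pow]

lemma le_algebraMap_iff_forall_re_inner {a : H →L[ℂ] H} (ha : IsSelfAdjoint a) (r : ℝ) :
    a ≤ algebraMap ℝ (H →L[ℂ] H) r ↔ ∀ h, (inner ℂ (a h) h).re ≤ r * ‖h‖ ^ 2 := by
  rw [← neg_le_neg_iff, ← map_neg, algebraMap_le_iff_forall_re_inner ha.neg]
  simp

lemma norm_le_norm_apply_of_one_le {a : H →L[ℂ] H} (ha : 1 ≤ a) (h : H) : ‖h‖ ≤ ‖a h‖ := by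
  have hsa : IsSelfAdjoint a := (IsSelfAdjoint.of_nonneg (zero_le_one.trans ha))
  have h1 := (algebraMap_le_iff_forall_re_inner hsa 1).1 (by simpa using ha) h
  have h2 := (Complex.re_le_norm _).trans (norm_inner_le_norm (𝕜 := ℂ) (a h) h)
  rcases (norm_nonneg h).eq_or_lt with h0 | h0
  · rw [← h0]; positivity
  · nlinarith

lemma exists_sixth_root {a : H →L[ℂ] H} {ρ : ℝ≥0} (h1 : 1 ≤ a)
    (h2 : a ≤ algebraMap ℝ≥0 (H →L[ℂ] H) (ρ ^ 3)) :
    ∃ x : H →L[ℂ] H, 1 ≤ x ∧ 1 ≤ x ^ 2 ∧ x ^ 2 ≤ algebraMap ℝ≥0 (H →L[ℂ] H) ρ ∧ x ^ 6 = a := by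
  have ha0 : 0 ≤ a := zero_le_one.trans h1
  have hroot : ∀ n : ℕ, (a ^ (1 / 6 : ℝ)) ^ n = a ^ (n / 6 : ℝ) := by
    intro n
    rw [← CFC.rpow_natCast _ n CFC.rpow_nonneg,
      CFC.rpow_rpow_of_exponent_nonneg a _ _ (by norm_num) (by positivity)]
    congr 1
    ring
  have hsq : (a ^ (1 / 6 : ℝ)) ^ 2 = a ^ (1 / 3 : ℝ) := by
    rw [hroot]; norm_num
  refine ⟨a ^ (1 / 6 : ℝ), ?_, ?_, ?_, ?_⟩
  · simpa using CFC.rpow_le_rpow (p := 1 / 6) (by norm_num) h1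
  · rw [hsq]
    simpa using CFC.rpow_le_rpow (p := 1 / 3) (by norm_num) h1
  · rw [hsq]
    refine (CFC.rpow_le_rpow (p := 1 / 3) (by norm_num) h2).trans_eq ?_
    rw [CFC.rpow_algebraMap, ← NNReal.rpow_natCast, ← NNReal.rpow_mul]
    norm_num
  · rw [hroot]
    norm_num
    exact CFC.rpow_one a

lemma norm_sub_one_le_half {a : H →L[ℂ] H} (h1 : 1 ≤ a)
    (h2 : a ≤ algebraMap ℝ≥0 (H →L[ℂ] H) (3 / 2)) : ‖a - 1‖ ≤ 1 / 2 := by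
  rw [CStarAlgebra.norm_le_iff_le_algebraMap (a - 1) (by norm_num) (sub_nonneg.2 h1),
    sub_le_iff_le_add]
  refine h2.trans_eq ?_
  rw [← map_one (algebraMap ℝ (H →L[ℂ] H)), ← map_add]
  change algebraMap ℝ (H →L[ℂ] H) ((3 / 2 : ℝ≥0) : ℝ) = _
  congr 1
  norm_num

lemma norm_sub_le_norm_add_of_le_pow (n : ℕ) : ∀ (a : K →L[ℂ] K) (b : H →L[ℂ] H), 1 ≤ a → 1 ≤ b →
    a ≤ algebraMap ℝ≥0 (K →L[ℂ] K) ((3 / 2) ^ 3 ^ n) →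
    b ≤ algebraMap ℝ≥0 (H →L[ℂ] H) ((3 / 2) ^ 3 ^ n) →
    ∀ Z : H →L[ℂ] K, ‖a ∘L Z - Z ∘L b‖ ≤ (1 + 2 * n) * ‖a ∘L Z + Z ∘L b‖ := by
  induction n with
  | zero =>
    intro a b ha hb ha' hb' Z
    have h1 := norm_sub_one_le_half ha (by simpa using ha')
    have h2 := norm_sub_one_le_half hb (by simpa using hb')
    have h3 : ‖(a - 1) ∘L Z‖ ≤ 1 / 2 * ‖Z‖ :=
      (ContinuousLinearMap.opNorm_comp_le _ _).trans (by gcongr)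
    have h4 : ‖Z ∘L (b - 1)‖ ≤ ‖Z‖ * (1 / 2) :=
      (ContinuousLinearMap.opNorm_comp_le _ _).trans (by gcongr)
    have h5 : a ∘L Z - Z ∘L b = (a - 1) ∘L Z - Z ∘L (b - 1) := by
      ext v; simp
    have h6 : (2 : ℂ) • Z = (a ∘L Z + Z ∘L b) - ((a - 1) ∘L Z + Z ∘L (b - 1)) := by
      ext v; simp; module
    have h7 := norm_sub_le (a ∘L Z + Z ∘L b) ((a - 1) ∘L Z + Z ∘L (b - 1))
    rw [← h6, norm_smul, Complex.norm_ofNat] at h7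
    have h8 := norm_add_le ((a - 1) ∘L Z) (Z ∘L (b - 1))
    have h9 := norm_sub_le ((a - 1) ∘L Z) (Z ∘L (b - 1))
    rw [h5]
    simp only [Nat.cast_zero, mul_zero, add_zero, one_mul]
    linarith
  | succ n ih =>
    intro a b ha hb ha' hb' Z
    rw [pow_succ 3 n, pow_mul] at ha' hb'
    obtain ⟨x, hx, hx1, hx2, rfl⟩ := exists_sixth_root ha ha'
    obtain ⟨y, hy, hy1, hy2, rfl⟩ := exists_sixth_root hb hb'
    have := norm_sub_le_norm_add_of_sq x y (IsSelfAdjoint.of_nonneg (zero_le_one.trans hx))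
      (IsSelfAdjoint.of_nonneg (zero_le_one.trans hy)) (norm_le_norm_apply_of_one_le hx)
      (norm_le_norm_apply_of_one_le hy) (1 + 2 * n) (ih _ _ hx1 hy1 hx2 hy2) Z
    refine this.trans_eq ?_
    push_cast
    ring

lemma inv_smul_mem_Icc_of_forall_inner {a : H →L[ℂ] H} (ha : IsSelfAdjoint a) {m : ℝ}
    (hm : 0 < m) {ρ : ℝ≥0} (h1 : ∀ h, m * ‖h‖ ^ 2 ≤ (inner ℂ (a h) h).re)
    (h2 : ∀ h, (inner ℂ (a h) h).re ≤ m * ρ * ‖h‖ ^ 2) :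
    1 ≤ m⁻¹ • a ∧ m⁻¹ • a ≤ algebraMap ℝ≥0 (H →L[ℂ] H) ρ := by
  have hsa : IsSelfAdjoint (m⁻¹ • a) := (IsSelfAdjoint.all m⁻¹).smul ha
  have hin : ∀ h, (inner ℂ ((m⁻¹ • a) h) h).re = m⁻¹ * (inner ℂ (a h) h).re := by
    intro h
    rw [smul_apply, ← Complex.coe_smul, inner_smul_left, Complex.conj_ofReal, Complex.re_ofReal_mul]
  constructor
  · rw [← map_one (algebraMap ℝ (H →L[ℂ] H)), algebraMap_le_iff_forall_re_inner hsa]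
    intro h
    rw [hin, one_mul, ← div_eq_inv_mul, le_div_iff₀' hm]
    exact h1 h
  · change _ ≤ algebraMap ℝ (H →L[ℂ] H) (ρ : ℝ)
    rw [le_algebraMap_iff_forall_re_inner hsa]
    intro h
    rw [hin, ← div_eq_inv_mul, div_le_iff₀' hm, ← mul_assoc]
    exact h2 h

/-- If the positive operators `a`, `b` have spectra in `[m, m * (3 / 2) ^ 3 ^ n]`, then
`a Z - Z b` is controlled by `a Z + Z b` with a constant linear in `n`. -/
lemma norm_sub_le_norm_add_of_forall_inner (n : ℕ) {m : ℝ} (hm : 0 < m)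
    {a : K →L[ℂ] K} {b : H →L[ℂ] H} (ha : IsSelfAdjoint a) (hb : IsSelfAdjoint b)
    (ha1 : ∀ k, m * ‖k‖ ^ 2 ≤ (inner ℂ (a k) k).re)
    (hb1 : ∀ h, m * ‖h‖ ^ 2 ≤ (inner ℂ (b h) h).re)
    (ha2 : ∀ k, (inner ℂ (a k) k).re ≤ m * (3 / 2) ^ 3 ^ n * ‖k‖ ^ 2)
    (hb2 : ∀ h, (inner ℂ (b h) h).re ≤ m * (3 / 2) ^ 3 ^ n * ‖h‖ ^ 2)
    (Z : H →L[ℂ] K) : ‖a ∘L Z - Z ∘L b‖ ≤ (1 + 2 * n) * ‖a ∘L Z + Z ∘L b‖ := by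
  obtain ⟨ha3, ha4⟩ := inv_smul_mem_Icc_of_forall_inner (ρ := (3 / 2) ^ 3 ^ n) ha hm ha1
    (by simpa using ha2)
  obtain ⟨hb3, hb4⟩ := inv_smul_mem_Icc_of_forall_inner (ρ := (3 / 2) ^ 3 ^ n) hb hm hb1
    (by simpa using hb2)
  have key := norm_sub_le_norm_add_of_le_pow n _ _ ha3 hb3 ha4 hb4 Z
  have e1 : (m⁻¹ • a) ∘L Z - Z ∘L (m⁻¹ • b) = m⁻¹ • (a ∘L Z - Z ∘L b) := by
    ext v; simp [smul_sub]
  have e2 : (m⁻¹ • a) ∘L Z + Z ∘L (m⁻¹ • b) = m⁻¹ • (a ∘L Z + Z ∘L b) := by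
    ext v; simp
  rw [e1, e2, norm_smul, norm_smul, mul_left_comm] at key
  exact le_of_mul_le_mul_left key (by simpa using hm.ne')

/-- Polar decomposition of a bounded-below operator with a given modulus. -/
lemma exists_isometry_comp_eq {S : H →L[ℂ] K} {a : H →L[ℂ] H} (ha : IsSelfAdjoint a)
    (hS : a ∘L a = S.adjoint ∘L S) {m : ℝ} (hm : 0 < m)
    (ha1 : ∀ h, m * ‖h‖ ^ 2 ≤ (inner ℂ (a h) h).re) :
    ∃ U : H →L[ℂ] K, (∀ h, U (a h) = S h) ∧ (∀ h, U.adjoint (U h) = h) ∧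
      (∀ h, U.adjoint (S h) = a h) ∧ (∀ k, a (U.adjoint k) = S.adjoint k) := by
  have hunit : IsUnit a := by
    refine ContinuousLinearMap.isUnit_of_forall_le_norm_inner_map a (c := ⟨m, hm.le⟩) hm fun h => ?_
    have := (ha1 h).trans (Complex.re_le_norm _)
    change ‖h‖ ^ 2 * m ≤ _
    linarith
  obtain ⟨a', haa', ha'a⟩ := isUnit_iff_exists.1 hunit
  have hsa' : IsSelfAdjoint a' := by
    have h1 : star a' * a = 1 := by
      have := congr_arg star haa'
      rwa [star_mul, ha.star_eq, star_one] at this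
    exact left_inv_eq_right_inv h1 haa'
  have h1 : ∀ h, a (a' h) = h := fun h => congr($haa' h)
  have h2 : ∀ h, a' (a h) = h := fun h => congr($ha'a h)
  have h3 : ∀ h, S.adjoint (S h) = a (a h) := fun h => (congr($hS h)).symm
  have hU : (S ∘L a').adjoint = a' ∘L S.adjoint := by
    rw [ContinuousLinearMap.adjoint_comp, hsa'.adjoint_eq]
  refine ⟨S ∘L a', fun h => ?_, fun h => ?_, fun h => ?_, fun k => ?_⟩ <;>
    simp [hU, h1, h2, h3]

lemma norm_le_one_of_adjoint_apply {U : H →L[ℂ] K} (hU : ∀ h, U.adjoint (U h) = h) :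
    ‖U‖ ≤ 1 := by
  have h1 : U.adjoint ∘L U = ContinuousLinearMap.id ℂ H := by ext h; simp [hU]
  have h2 := ContinuousLinearMap.norm_adjoint_comp_self U
  rw [h1] at h2
  nlinarith [ContinuousLinearMap.norm_id_le (𝕜 := ℂ) (E := H), norm_nonneg U]

lemma norm_sub_le_of_comp_self_eq (n : ℕ) {m : ℝ} (hm : 0 < m) {S T : H →L[ℂ] K}
    {a b : H →L[ℂ] H} (ha : IsSelfAdjoint a) (hb : IsSelfAdjoint b)
    (hS : a ∘L a = S.adjoint ∘L S) (hT : b ∘L b = T.adjoint ∘L T)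
    (ha1 : ∀ h, m * ‖h‖ ^ 2 ≤ (inner ℂ (a h) h).re)
    (hb1 : ∀ h, m * ‖h‖ ^ 2 ≤ (inner ℂ (b h) h).re)
    (ha2 : ∀ h, (inner ℂ (a h) h).re ≤ m * (3 / 2) ^ 3 ^ n * ‖h‖ ^ 2)
    (hb2 : ∀ h, (inner ℂ (b h) h).re ≤ m * (3 / 2) ^ 3 ^ n * ‖h‖ ^ 2) :
    ‖a - b‖ ≤ ‖S - T‖ + (1 + n) * (2 * ‖S - T‖ + 2 * m) := by
  obtain ⟨U, hU1, hU2, hU3, hU4⟩ := exists_isometry_comp_eq ha hS hm ha1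
  obtain ⟨V, hV1, hV2, -, hV4⟩ := exists_isometry_comp_eq hb hT hm hb1
  have hUn := norm_le_one_of_adjoint_apply hU2
  have hVn := norm_le_one_of_adjoint_apply hV2
  have hUn' : ‖U.adjoint‖ ≤ 1 := by simpa using hUn
  set P : K →L[ℂ] K := 1 - U ∘L U.adjoint with hP
  set A : K →L[ℂ] K := U ∘L a ∘L U.adjoint + m • P with hA
  have hPsa : IsSelfAdjoint P := by
    refine (IsSelfAdjoint.one _).sub ?_
    rw [ContinuousLinearMap.isSelfAdjoint_iff', ContinuousLinearMap.adjoint_comp,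
      ContinuousLinearMap.adjoint_adjoint]
  have hAsa : IsSelfAdjoint A := by
    refine IsSelfAdjoint.add ?_ ((IsSelfAdjoint.all m).smul hPsa)
    rw [ContinuousLinearMap.isSelfAdjoint_iff', ContinuousLinearMap.adjoint_comp,
      ContinuousLinearMap.adjoint_comp, ContinuousLinearMap.adjoint_adjoint, ha.adjoint_eq]
    rfl
  have hin : ∀ k, (inner ℂ (A k) k).re = (inner ℂ (a (U.adjoint k)) (U.adjoint k)).re +
      m * (‖k‖ ^ 2 - ‖U.adjoint k‖ ^ 2) := by
    intro k
    have h1 : A k = U (a (U.adjoint k)) + (m : ℂ) • (k - U (U.adjoint k)) := by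
      simp [hA, hP]
    rw [h1, inner_add_left, inner_smul_left, inner_sub_left,
      ← ContinuousLinearMap.adjoint_inner_right U, ← ContinuousLinearMap.adjoint_inner_right U,
      inner_self_eq_norm_sq_to_K, inner_self_eq_norm_sq_to_K]
    simp [← Complex.ofReal_pow, ← Complex.ofReal_sub]
  have hUk : ∀ k, ‖U.adjoint k‖ ^ 2 ≤ ‖k‖ ^ 2 := fun k => by
    gcongr
    exact (U.adjoint.le_opNorm k).trans (mul_le_of_le_one_left (norm_nonneg _) hUn')
  have hA1 : ∀ k, m * ‖k‖ ^ 2 ≤ (inner ℂ (A k) k).re := fun k => by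
    rw [hin]; linarith [ha1 (U.adjoint k)]
  have hA2 : ∀ k, (inner ℂ (A k) k).re ≤ m * (3 / 2) ^ 3 ^ n * ‖k‖ ^ 2 := fun k => by
    rw [hin]
    have h1 : m * 1 ≤ m * (3 / 2) ^ 3 ^ n := by
      gcongr
      exact one_le_pow₀ (by norm_num)
    nlinarith [ha2 (U.adjoint k), hUk k]
  set Z := U - V with hZ
  set D := S - T with hD
  have key := norm_sub_le_norm_add_of_forall_inner n hm hAsa hb hA1 hb1 hA2 hb2 Z
  have hsum : A ∘L Z + Z ∘L b = D - U ∘L D.adjoint ∘L V - m • (P ∘L V) := by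
    ext h
    have h1 : T.adjoint (V h) = b h := by rw [← hV4, hV2]
    simp [hA, hZ, hD, hP, hU1, hU2, hU4, hV1, h1]
    abel
  have hPn : ‖P‖ ≤ 2 := by
    have h1 : ‖U ∘L U.adjoint‖ ≤ 1 :=
      (ContinuousLinearMap.opNorm_comp_le _ _).trans (mul_le_one₀ hUn (norm_nonneg _) hUn')
    have h2 : ‖(1 : K →L[ℂ] K)‖ ≤ 1 := ContinuousLinearMap.norm_id_le
    linarith [norm_sub_le (1 : K →L[ℂ] K) (U ∘L U.adjoint)]
  have hsumn : ‖A ∘L Z + Z ∘L b‖ ≤ 2 * ‖D‖ + 2 * m := by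
    have h1 : ‖U ∘L D.adjoint ∘L V‖ ≤ ‖D‖ := by
      calc ‖U ∘L D.adjoint ∘L V‖ ≤ ‖U‖ * (‖D.adjoint‖ * ‖V‖) :=
            (ContinuousLinearMap.opNorm_comp_le _ _).trans
              (by gcongr; exact ContinuousLinearMap.opNorm_comp_le _ _)
        _ ≤ 1 * (‖D.adjoint‖ * 1) := by gcongr
        _ = ‖D‖ := by simp
    have h2 : ‖m • (P ∘L V)‖ ≤ m * (2 * 1) := by
      rw [norm_smul, Real.norm_of_nonneg hm.le]
      gcongr
      exact (ContinuousLinearMap.opNorm_comp_le _ _).trans (by gcongr)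
    rw [hsum]
    linarith [norm_sub_le (D - U ∘L D.adjoint ∘L V) (m • (P ∘L V)),
      norm_sub_le D (U ∘L D.adjoint ∘L V)]
  have hZb : ‖Z ∘L b‖ ≤ (1 + n) * (2 * ‖D‖ + 2 * m) := by
    have h1 : (2 : ℂ) • (Z ∘L b) = (A ∘L Z + Z ∘L b) - (A ∘L Z - Z ∘L b) := by module
    have h2 := norm_sub_le (A ∘L Z + Z ∘L b) (A ∘L Z - Z ∘L b)
    rw [← h1, norm_smul, Complex.norm_ofNat] at h2
    have h3 : (1 + n) * ‖A ∘L Z + Z ∘L b‖ ≤ (1 + n) * (2 * ‖D‖ + 2 * m) := by gcongr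
    linarith
  have hab : a - b = U.adjoint ∘L (D - Z ∘L b) := by
    ext h
    simp [hD, hZ, hU2, hU3, hV1]
  calc ‖a - b‖ ≤ ‖U.adjoint‖ * ‖D - Z ∘L b‖ := hab ▸ ContinuousLinearMap.opNorm_comp_le _ _
    _ ≤ 1 * (‖D‖ + ‖Z ∘L b‖) := by
      gcongr
      exact norm_sub_le _ _
    _ ≤ _ := by linarith

/-- The operator `h ↦ (S h, ε h)`. -/
noncomputable def columnWithScalar (S : H →L[ℂ] H) (ε : ℝ) : H →L[ℂ] WithLp 2 (H × H) :=
  (WithLp.prodContinuousLinearEquiv 2 ℂ H H).symm.toContinuousLinearMap ∘L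
    (S.prod ((ε : ℂ) • ContinuousLinearMap.id ℂ H))

lemma columnWithScalar_adjoint_comp_self (S : H →L[ℂ] H) (ε : ℝ) :
    (columnWithScalar S ε).adjoint ∘L columnWithScalar S ε =
      star S * S + algebraMap ℝ (H →L[ℂ] H) (ε ^ 2) := by
  ext h
  refine ext_inner_left ℂ fun k => ?_
  rw [ContinuousLinearMap.comp_apply, ContinuousLinearMap.adjoint_inner_right,
    WithLp.prod_inner_apply]
  simp [columnWithScalar, ContinuousLinearMap.star_eq_adjoint, inner_add_right,
    ContinuousLinearMap.adjoint_inner_right, Algebra.algebraMap_eq_smul_one]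
  simp only [← Complex.coe_smul, inner_smul_left, inner_smul_right, Complex.conj_ofReal]
  push_cast
  ring

lemma norm_columnWithScalar_sub (S T : H →L[ℂ] H) (ε : ℝ) :
    ‖columnWithScalar S ε - columnWithScalar T ε‖ ≤ ‖S - T‖ := by
  refine ContinuousLinearMap.opNorm_le_bound _ (norm_nonneg _) fun h => ?_
  have h1 : (columnWithScalar S ε - columnWithScalar T ε) h = WithLp.toLp 2 ((S - T) h, 0) := by
    simp [columnWithScalar, ← WithLp.toLp_sub]
  rw [h1, WithLp.norm_toLp_fst]
  exact (S - T).le_opNorm h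

/-- `(S*S + ε²)^{1/2}` is squeezed between `ε` and `‖S‖ + ε`, and is `ε`-close to `|S|`. -/
lemma exists_sqrt_add_sq (S : H →L[ℂ] H) {ε : ℝ} (hε : 0 ≤ ε) :
    ∃ a : H →L[ℂ] H, IsSelfAdjoint a ∧
      a ∘L a = star S * S + algebraMap ℝ (H →L[ℂ] H) (ε ^ 2) ∧
      (∀ h, ε * ‖h‖ ^ 2 ≤ (inner ℂ (a h) h).re) ∧
      (∀ h, (inner ℂ (a h) h).re ≤ (‖S‖ + ε) * ‖h‖ ^ 2) ∧
      ‖cfc Real.sqrt (star S * S) - a‖ ≤ ε := by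
  have hsa : IsSelfAdjoint (star S * S) := .star_mul_self S
  have hspec : ∀ t ∈ spectrum ℝ (star S * S), 0 ≤ t ∧ t ≤ ‖S‖ ^ 2 := by
    intro t ht
    refine ⟨spectrum_nonneg_of_nonneg (star_mul_self_nonneg S) ht, ?_⟩
    have hle := spectrum.norm_le_norm_mul_of_mem ht
    have h2 : ‖(1 : H →L[ℂ] H)‖ ≤ 1 := ContinuousLinearMap.norm_id_le
    rw [CStarRing.norm_star_mul_self] at hle
    calc t ≤ ‖t‖ := le_abs_self t
      _ ≤ ‖S‖ * ‖S‖ * ‖(1 : H →L[ℂ] H)‖ := hle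
      _ ≤ ‖S‖ * ‖S‖ * 1 := by gcongr
      _ = ‖S‖ ^ 2 := by ring
  have hcont : Continuous fun t : ℝ => √(t + ε ^ 2) := by fun_prop
  have ha : IsSelfAdjoint (cfc (fun t : ℝ => √(t + ε ^ 2)) (star S * S)) := cfc_predicate _ _
  refine ⟨cfc (fun t : ℝ => √(t + ε ^ 2)) (star S * S), ha, ?_, ?_, ?_, ?_⟩
  · rw [← ContinuousLinearMap.mul_def, ← cfc_mul _ _ _ hcont.continuousOn hcont.continuousOn]
    have h1 : (spectrum ℝ (star S * S)).EqOn (fun t => √(t + ε ^ 2) * √(t + ε ^ 2))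
        (fun t => t + ε ^ 2) := fun t ht =>
      Real.mul_self_sqrt (add_nonneg (hspec t ht).1 (sq_nonneg ε))
    rw [cfc_congr h1, cfc_add_const _ _ _, cfc_id' ℝ (star S * S)]
  · rw [← algebraMap_le_iff_forall_re_inner ha,
      algebraMap_le_cfc_iff _ _ _ hcont.continuousOn]
    intro t ht
    exact Real.le_sqrt_of_sq_le (by linarith [(hspec t ht).1])
  · rw [← le_algebraMap_iff_forall_re_inner ha,
      cfc_le_algebraMap_iff _ _ _ hcont.continuousOn]
    intro t ht
    refine Real.sqrt_le_iff.2 ⟨by positivity, ?_⟩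
    nlinarith [(hspec t ht).2, norm_nonneg S]
  · rw [← cfc_sub _ _ _ Real.continuous_sqrt.continuousOn hcont.continuousOn]
    refine norm_cfc_le hε fun t ht => ?_
    have h0 := (hspec t ht).1
    rw [Real.norm_eq_abs, abs_le]
    constructor
    · have : √(t + ε ^ 2) ≤ √t + ε := by
        refine Real.sqrt_le_iff.2 ⟨by positivity, ?_⟩
        nlinarith [Real.sq_sqrt h0, mul_nonneg (Real.sqrt_nonneg t) hε]
      linarith
    · have : √t ≤ √(t + ε ^ 2) := Real.sqrt_le_sqrt (by nlinarith)
      linarith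

end Sylvester

lemma norm_opAbs_sub_le {H : Type} [NormedAddCommGroup H] [InnerProductSpace ℂ H]
    [CompleteSpace H] (n : ℕ) (S T : H →L[ℂ] H) (hST : S ≠ T)
    (hn : 2 * (‖S‖ + ‖T‖) ≤ ‖S - T‖ * (3 / 2) ^ 3 ^ n) :
    ‖opAbs S - opAbs T‖ ≤ (7 + 4 * n) * ‖S - T‖ := by
  have hd : 0 < ‖S - T‖ := norm_pos_iff.2 (sub_ne_zero.2 hST)
  obtain ⟨a, ha, ha0, ha1, ha2, ha3⟩ := exists_sqrt_add_sq S hd.le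
  obtain ⟨b, hb, hb0, hb1, hb2, hb3⟩ := exists_sqrt_add_sq T hd.le
  have hle := norm_sub_le S T
  have key := norm_sub_le_of_comp_self_eq n hd ha hb
    (ha0.trans (columnWithScalar_adjoint_comp_self S _).symm)
    (hb0.trans (columnWithScalar_adjoint_comp_self T _).symm) ha1 hb1
    (fun h => (ha2 h).trans (by gcongr; linarith [norm_nonneg T]))
    (fun h => (hb2 h).trans (by gcongr; linarith [norm_nonneg S]))
  have hc := norm_columnWithScalar_sub S T ‖S - T‖
  have key2 : ‖a - b‖ ≤ ‖S - T‖ + (1 + n) * (2 * ‖S - T‖ + 2 * ‖S - T‖) :=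
    key.trans (by gcongr)
  have htri : opAbs S - opAbs T = (cfc Real.sqrt (star S * S) - a) + (a - b) -
      (cfc Real.sqrt (star T * T) - b) := by
    unfold opAbs; abel
  rw [htri]
  have h1 := norm_sub_le ((cfc Real.sqrt (star S * S) - a) + (a - b))
    (cfc Real.sqrt (star T * T) - b)
  have h2 := norm_add_le (cfc Real.sqrt (star S * S) - a) (a - b)
  linarith

lemma exists_two_mul_exp_le_pow {l : ℝ} (hl : 0 ≤ l) :
    ∃ n : ℕ, 2 * Real.exp l ≤ (3 / 2) ^ 3 ^ n ∧ (n : ℝ) ≤ Real.log (2 + l) + 2 := by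
  set j := ⌈Real.log (2 + l)⌉₊ with hj
  have hlog : 0 ≤ Real.log (2 + l) := Real.log_nonneg (by linarith)
  have he : Real.exp 1 ≤ 3 := by linarith [Real.exp_one_lt_d9]
  have hj1 : 2 + l ≤ (3 : ℝ) ^ j := by
    calc 2 + l = Real.exp (Real.log (2 + l)) := (Real.exp_log (by linarith)).symm
      _ ≤ Real.exp j := Real.exp_le_exp.2 (Nat.le_ceil _)
      _ = Real.exp 1 ^ j := by rw [← Real.exp_nat_mul, mul_one]
      _ ≤ 3 ^ j := by gcongr
  refine ⟨j + 1, ?_, ?_⟩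
  · have h2 : (2 : ℝ) ≤ Real.exp 1 := by linarith [Real.exp_one_gt_d9]
    calc 2 * Real.exp l ≤ Real.exp 1 * Real.exp l := by gcongr
      _ = Real.exp (1 + l) := (Real.exp_add _ _).symm
      _ ≤ Real.exp ((3 ^ j : ℕ) : ℝ) := Real.exp_le_exp.2 (by push_cast; linarith)
      _ = Real.exp 1 ^ 3 ^ j := by rw [← Real.exp_nat_mul, mul_one]
      _ ≤ ((3 / 2) ^ 3) ^ 3 ^ j := by
        gcongr
        norm_num
        linarith [Real.exp_one_lt_d9]
      _ = (3 / 2) ^ 3 ^ (j + 1) := by rw [← pow_mul, pow_succ, mul_comm]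
  · have := (Nat.ceil_lt_add_one hlog).le
    push_cast
    linarith

theorem stmt0 :
    ∃ C : ℝ, 0 < C ∧
      ∀ (H : Type) [NormedAddCommGroup H] [InnerProductSpace ℂ H] [CompleteSpace H]
        (S T : H →L[ℂ] H), S ≠ T →
        ‖opAbs S - opAbs T‖ ≤
          C * ‖S - T‖ * Real.log (2 + Real.log ((‖S‖ + ‖T‖) / ‖S - T‖)) := by
  refine ⟨34, by norm_num, fun H _ _ _ S T hST => ?_⟩
  have hd : 0 < ‖S - T‖ := norm_pos_iff.2 (sub_ne_zero.2 hST)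
  have hratio : 1 ≤ (‖S‖ + ‖T‖) / ‖S - T‖ := (one_le_div hd).2 (norm_sub_le S T)
  have hl := Real.log_nonneg hratio
  obtain ⟨n, hn1, hn2⟩ := exists_two_mul_exp_le_pow hl
  rw [Real.exp_log (by linarith), mul_div_assoc', div_le_iff₀' hd] at hn1
  refine (norm_opAbs_sub_le n S T hST hn1).trans ?_
  set L := Real.log (2 + Real.log ((‖S‖ + ‖T‖) / ‖S - T‖))
  have hL : 1 / 2 ≤ L := by
    have h1 : Real.log 2 ≤ L := Real.log_le_log (by norm_num) (by linarith)
    linarith [Real.log_two_gt_d9]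
  calc (7 + 4 * (n : ℝ)) * ‖S - T‖ ≤ (34 * L) * ‖S - T‖ := by gcongr; linarith
    _ = 34 * ‖S - T‖ * L := by ring
end

section
/- There exists a constant C > 0 such that for every a > 0, every δ > 0, and all bounded self-adjoint operators A, B on a complex Hilbert space whose spectra are contained in [−a, ∞) and which satisfy ‖A − B‖ ≤ δ, one has ‖ |A| − |B| ‖ ≤ C · δ · log(2 + max(log(a/δ), 0)). -/
open MeasureTheory ENNReal

section CStarAlgebra

variable {𝒜 : Type*} [CStarAlgebra 𝒜] [PartialOrder 𝒜] [StarOrderedRing 𝒜]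

lemma isSelfAdjoint_of_smul_one_le {P : 𝒜} {p : ℝ} (hP : p • (1 : 𝒜) ≤ P) :
    IsSelfAdjoint P := by
  have h : IsSelfAdjoint (P - p • (1 : 𝒜)) := .of_nonneg (sub_nonneg.2 hP)
  simpa using h.add ((IsSelfAdjoint.all p).smul (IsSelfAdjoint.one 𝒜))

lemma norm_le_of_nonneg_of_le_smul_one {P : 𝒜} {r : ℝ} (hr : 0 ≤ r) (h0 : 0 ≤ P)
    (h : P ≤ r • (1 : 𝒜)) : ‖P‖ ≤ r :=
  (CStarAlgebra.norm_le_iff_le_algebraMap P hr h0).2 (by rwa [Algebra.algebraMap_eq_smul_one])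

lemma norm_one_sub_smul_le {P : 𝒜} {p t : ℝ} (hP : p • (1 : 𝒜) ≤ P) (ht : 0 ≤ t)
    (htP : t * ‖P‖ ≤ 1) (htp : t * p ≤ 1) : ‖1 - t • P‖ ≤ 1 - t * p := by
  refine norm_le_of_nonneg_of_le_smul_one (by linarith) ?_ ?_
  · have h := (isSelfAdjoint_of_smul_one_le hP).le_algebraMap_norm_self
    rw [Algebra.algebraMap_eq_smul_one] at h
    have h1 := smul_le_smul_of_nonneg_left h ht
    have h2 : (t * ‖P‖) • (1 : 𝒜) ≤ (1 : ℝ) • (1 : 𝒜) :=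
      smul_le_smul_of_nonneg_right htP zero_le_one
    rw [smul_smul] at h1
    rw [one_smul] at h2
    exact sub_nonneg.2 (h1.trans h2)
  · have h1 := smul_le_smul_of_nonneg_left hP ht
    rw [smul_smul] at h1
    rw [sub_smul, one_smul]
    exact sub_le_sub_left h1 _

/-- Lower bound for the Sylvester operator `Z ↦ P * Z + Z * Q`. -/
lemma add_mul_norm_le_norm_mul_add_mul {P Q Z : 𝒜} {p q : ℝ} (hP : p • (1 : 𝒜) ≤ P)
    (hQ : q • (1 : 𝒜) ≤ Q) : (p + q) * ‖Z‖ ≤ ‖P * Z + Z * Q‖ := by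
  have small (k : ℝ) : ∀ᶠ t : ℝ in nhdsWithin 0 (Set.Ioi 0), t * k < 1 := by
    refine nhdsWithin_le_nhds (ContinuousAt.eventually_lt (by fun_prop) (by fun_prop) ?_)
    simp
  have key : ∀ᶠ t : ℝ in nhdsWithin 0 (Set.Ioi 0),
      (p + q - t * (p * q)) * ‖Z‖ ≤ ‖P * Z + Z * Q‖ + t * ‖P * Z * Q‖ := by
    filter_upwards [small p, small q, small ‖P‖, small ‖Q‖, self_mem_nhdsWithin]
      with t h1 h2 h3 h4 (ht : 0 < t)
    have e : Z = (1 - t • P) * Z * (1 - t • Q) + t • (P * Z + Z * Q)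
        - (t * t) • (P * Z * Q) := by
      simp only [sub_mul, mul_sub, one_mul, mul_one, smul_mul_assoc, mul_smul_comm, smul_add,
        smul_smul, smul_sub]
      abel
    have h5 : ‖(1 - t • P) * Z * (1 - t • Q)‖ ≤ (1 - t * p) * ‖Z‖ * (1 - t * q) := by
      refine (norm_mul_le _ _).trans (mul_le_mul ((norm_mul_le _ _).trans ?_)
        (norm_one_sub_smul_le hQ ht.le h4.le h2.le) (norm_nonneg _) ?_)
      · exact mul_le_mul_of_nonneg_right (norm_one_sub_smul_le hP ht.le h3.le h1.le)
          (norm_nonneg _)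
      · exact mul_nonneg (by linarith) (norm_nonneg _)
    have h6 : ‖Z‖ ≤ (1 - t * p) * ‖Z‖ * (1 - t * q) + t * ‖P * Z + Z * Q‖
        + (t * t) * ‖P * Z * Q‖ := by
      calc ‖Z‖ = ‖(1 - t • P) * Z * (1 - t • Q) + t • (P * Z + Z * Q)
            - (t * t) • (P * Z * Q)‖ := by rw [← e]
        _ ≤ ‖(1 - t • P) * Z * (1 - t • Q)‖ + ‖t • (P * Z + Z * Q)‖
            + ‖(t * t) • (P * Z * Q)‖ :=
          (norm_sub_le _ _).trans (add_le_add_left (norm_add_le _ _) _)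
        _ ≤ _ := by
          rw [norm_smul, norm_smul, Real.norm_of_nonneg ht.le,
            Real.norm_of_nonneg (mul_self_nonneg t)]
          gcongr
    have h7 : t * ((p + q - t * (p * q)) * ‖Z‖) ≤ t * (‖P * Z + Z * Q‖ + t * ‖P * Z * Q‖) := by
      linarith
    exact le_of_mul_le_mul_left h7 ht
  have lim1 : Filter.Tendsto (fun t : ℝ => (p + q - t * (p * q)) * ‖Z‖)
      (nhdsWithin 0 (Set.Ioi 0)) (nhds ((p + q) * ‖Z‖)) :=
    ((Continuous.tendsto' (by fun_prop) 0 _ (by simp)).mono_left nhdsWithin_le_nhds)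
  have lim2 : Filter.Tendsto (fun t : ℝ => ‖P * Z + Z * Q‖ + t * ‖P * Z * Q‖)
      (nhdsWithin 0 (Set.Ioi 0)) (nhds ‖P * Z + Z * Q‖) :=
    ((Continuous.tendsto' (by fun_prop) 0 _ (by simp)).mono_left nhdsWithin_le_nhds)
  exact le_of_tendsto_of_tendsto lim1 lim2 key

lemma star_mul_self_le_smul_of_norm_le {T F : 𝒜} {k : ℝ} (hF : IsStarProjection F)
    (hTF : T * F = T) (hT : ‖T‖ ≤ k) : star T * T ≤ (k ^ 2) • F := by
  have hk : ‖star T * T‖ ≤ k ^ 2 := by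
    rw [CStarRing.norm_star_mul_self, ← sq]
    gcongr
  have h := (CStarAlgebra.norm_le_iff_le_algebraMap (star T * T) (sq_nonneg k)
    (star_mul_self_nonneg T)).1 hk
  rw [Algebra.algebraMap_eq_smul_one] at h
  have h2 := star_left_conjugate_le_conjugate h F
  have e : star F * (star T * T) * F = star T * T := by
    rw [← mul_assoc, ← star_mul, hTF, mul_assoc, hTF]
  rwa [e, mul_smul_comm, mul_one, smul_mul_assoc, hF.isSelfAdjoint.star_eq,
    hF.isIdempotentElem.eq] at h2

/-- The norm of a block-diagonal sum is at most the maximum of the norms of the blocks. -/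
lemma norm_add_le_of_block_diagonal {S T E F : 𝒜} {k : ℝ} (hE : IsStarProjection E)
    (hF : IsStarProjection F) (hES : E * S = 0) (hSF : S * F = 0) (hET : E * T = T)
    (hTF : T * F = T) (hS : ‖S‖ ≤ k) (hT : ‖T‖ ≤ k) : ‖S + T‖ ≤ k := by
  have hk : 0 ≤ k := (norm_nonneg _).trans hS
  have h1 := star_mul_self_le_smul_of_norm_le hF hTF hT
  have h2 := star_mul_self_le_smul_of_norm_le hF.one_sub (T := S) (by simp [mul_sub, hSF]) hS
  have hTS : star T * S = 0 := by
    rw [← hET, star_mul, hE.isSelfAdjoint.star_eq, mul_assoc, hES, mul_zero]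
  have hST : star S * T = 0 := by
    have := congrArg star hTS
    simpa using this
  have h3 : star (S + T) * (S + T) ≤ (k ^ 2) • (1 : 𝒜) := by
    have e : star (S + T) * (S + T) = star S * S + star T * T := by
      rw [star_add, add_mul, mul_add, mul_add, hTS, hST, add_zero, zero_add]
    have := add_le_add h2 h1
    rwa [← smul_add, sub_add_cancel, ← e] at this
  have h4 := norm_le_of_nonneg_of_le_smul_one (sq_nonneg k) (star_mul_self_nonneg _) h3
  rw [CStarRing.norm_star_mul_self, ← sq] at h4
  exact (sq_le_sq₀ (norm_nonneg _) hk).1 h4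

end CStarAlgebra

section Hilbert

variable {H : Type*} [NormedAddCommGroup H] [InnerProductSpace ℂ H] [CompleteSpace H]

/-- The projection onto the closure of the range of the positive part. -/
lemma exists_isStarProjection_posPart (R : H →L[ℂ] H) :
    ∃ E : H →L[ℂ] H, IsStarProjection E ∧ E * R⁺ = R⁺ ∧ R⁺ * E = R⁺ ∧
      E * R⁻ = 0 ∧ R⁻ * E = 0 := by
  let K : Submodule ℂ H := (R⁻).ker
  have : CompleteSpace K := (R⁻).isClosed_ker.completeSpace_coe
  have hE : IsStarProjection K.starProjection := isStarProjection_starProjection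
  have h1 : K.starProjection * R⁺ = R⁺ := by
    ext x
    refine Submodule.starProjection_eq_self_iff.2 ?_
    exact congrArg (fun T : H →L[ℂ] H => T x) (CFC.negPart_mul_posPart R)
  have h2 : R⁻ * K.starProjection = 0 := by
    ext x
    exact Submodule.starProjection_apply_mem K x
  have hp : IsSelfAdjoint R⁺ := .of_nonneg (CFC.posPart_nonneg R)
  have hn : IsSelfAdjoint R⁻ := .of_nonneg (CFC.negPart_nonneg R)
  refine ⟨K.starProjection, hE, h1, ?_, ?_, h2⟩
  · have := congrArg star h1
    rwa [star_mul, hp.star_eq, hE.isSelfAdjoint.star_eq] at this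
  · have := congrArg star h2
    rwa [star_mul, hn.star_eq, hE.isSelfAdjoint.star_eq, star_zero] at this

/-- `E` splits `P` at level `c`: on the range of `E` it acts as `Phi ≥ c`, on the complement
as `Plo ≤ c`. -/
structure IsSpectralSplit (P E Plo Phi : H →L[ℂ] H) (c : ℝ) : Prop where
  proj : IsStarProjection E
  mul_hi : E * P = Phi * E
  hi_mul : P * E = E * Phi
  mul_lo : (1 - E) * P = Plo * (1 - E)
  lo_mul : P * (1 - E) = (1 - E) * Plo
  lo_le : Plo ≤ c • 1
  le_hi : c • 1 ≤ Phi
  le_lo : ∀ b : ℝ, b ≤ c → b • 1 ≤ P → b • 1 ≤ Plo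
  hi_le : ∀ b : ℝ, c ≤ b → P ≤ b • 1 → Phi ≤ b • 1

lemma exists_isSpectralSplit {P : H →L[ℂ] H} (hP : IsSelfAdjoint P) (c : ℝ) :
    ∃ E Plo Phi : H →L[ℂ] H, IsSpectralSplit P E Plo Phi c := by
  set R : H →L[ℂ] H := P - c • 1 with hR
  have hRs : IsSelfAdjoint R := hP.sub ((IsSelfAdjoint.all c).smul (IsSelfAdjoint.one _))
  obtain ⟨E, hE, h1, h2, h3, h4⟩ := exists_isStarProjection_posPart R
  have hd : P = c • 1 + (R⁺ - R⁻) := by rw [CFC.posPart_sub_negPart R hRs, hR]; abel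
  have conj (G : H →L[ℂ] H) (hG : IsStarProjection G) (b : ℝ) (hb : 0 ≤ b) (S : H →L[ℂ] H)
      (hS : S ≤ b • 1) : G * S * G ≤ b • 1 := by
    have h := star_left_conjugate_le_conjugate hS G
    rw [hG.isSelfAdjoint.star_eq, mul_smul_comm, mul_one, smul_mul_assoc,
      hG.isIdempotentElem.eq] at h
    refine h.trans (smul_le_smul_of_nonneg_left ?_ hb)
    exact sub_nonneg.1 hG.one_sub.nonneg
  refine ⟨E, c • 1 - R⁻, c • 1 + R⁺, hE, ?_, ?_, ?_, ?_, ?_, ?_, ?_, ?_⟩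
  · rw [hd]; simp [mul_add, add_mul, mul_sub, h1, h2, h3]
  · rw [hd]; simp [mul_add, add_mul, sub_mul, h1, h2, h4]
  · rw [hd]; simp [mul_add, mul_sub, sub_mul, smul_sub, h1, h3, h4]; abel
  · rw [hd]; simp [add_mul, mul_sub, sub_mul, smul_sub, h2, h3, h4]; abel
  · exact sub_le_self _ (CFC.negPart_nonneg R)
  · exact le_add_of_nonneg_right (CFC.posPart_nonneg R)
  · intro b hb hbP
    have e : (1 - E) * (-R) * (1 - E) = R⁻ := by
      nth_rw 1 [← CFC.posPart_sub_negPart R hRs]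
      simp [mul_sub, sub_mul, h1, h3, h4]
    have h := conj (1 - E) hE.one_sub (c - b) (sub_nonneg.2 hb) (-R) (by
      rw [hR, sub_smul, neg_sub]; exact sub_le_sub_left hbP _)
    rw [e, sub_smul] at h
    exact le_sub_comm.1 h
  · intro b hb hbP
    have e : E * R * E = R⁺ := by
      nth_rw 1 [← CFC.posPart_sub_negPart R hRs]
      simp [mul_sub, h1, h2, h3]
    have h := conj E hE (b - c) (sub_nonneg.2 hb) R (by
      rw [hR, sub_smul]; exact sub_le_sub_right hbP _)
    rw [e, sub_smul] at h
    exact le_sub_iff_add_le'.1 h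

lemma IsStarProjection.norm_mul_mul_le {E F : H →L[ℂ] H} (hE : IsStarProjection E)
    (hF : IsStarProjection F) (X : H →L[ℂ] H) : ‖E * X * F‖ ≤ ‖X‖ := by
  have h1 : ‖E‖ ≤ 1 := hE.norm_le
  have h2 : ‖F‖ ≤ 1 := hF.norm_le
  calc ‖E * X * F‖ ≤ ‖E‖ * ‖X‖ * ‖F‖ :=
        (norm_mul_le _ _).trans (mul_le_mul_of_nonneg_right (norm_mul_le _ _) (norm_nonneg _))
    _ ≤ 1 * ‖X‖ * 1 := by gcongr
    _ = ‖X‖ := by ring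

/-- Each doubling of the logarithmic range of `P` costs only an additive constant. -/
lemma norm_mul_le_of_sylvester (n : ℕ) {c : ℝ} (hc : 0 < c) {P Q : H →L[ℂ] H}
    (hcP : c • 1 ≤ P) (hPc : P ≤ (2 ^ 2 ^ n * c) • 1) (hcQ : c • 1 ≤ Q) (Z : H →L[ℂ] H) :
    ‖P * Z‖ ≤ (3 * n + 1) * ‖P * Z + Z * Q‖ := by
  induction n generalizing c P Q Z with
  | zero =>
    have h := add_mul_norm_le_norm_mul_add_mul (Z := Z) hcP hcQ
    have hP0 : 0 ≤ P := (smul_nonneg hc.le zero_le_one).trans hcP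
    have hn : ‖P‖ ≤ 2 * c := norm_le_of_nonneg_of_le_smul_one (by positivity) hP0
      (by simpa using hPc)
    calc ‖P * Z‖ ≤ ‖P‖ * ‖Z‖ := norm_mul_le _ _
      _ ≤ (2 * c) * ‖Z‖ := by gcongr
      _ ≤ _ := by push_cast; linarith
  | succ n ih =>
    set r : ℝ := 2 ^ 2 ^ n with hr
    have hr1 : 1 ≤ r := one_le_pow₀ (by norm_num)
    have hcd : c ≤ r * c := le_mul_of_one_le_left hc.le hr1
    have hd : 0 < r * c := by positivity
    have hrr : (2 : ℝ) ^ 2 ^ (n + 1) * c = r * (r * c) := by rw [hr]; ring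
    rw [hrr] at hPc
    obtain ⟨E, P₁, P₂, hE⟩ := exists_isSpectralSplit (isSelfAdjoint_of_smul_one_le hcP) (r * c)
    obtain ⟨F, Q₁, Q₂, hF⟩ := exists_isSpectralSplit (isSelfAdjoint_of_smul_one_le hcQ) (r * c)
    have hP₁ := hE.le_lo c hcd hcP
    have hQ₁ := hF.le_lo c hcd hcQ
    have hP₂ := hE.hi_le _ (le_mul_of_one_le_left hd.le hr1) hPc
    set Y := P * Z + Z * Q with hY
    have block (G G' P' Q' : H →L[ℂ] H) (h : G * P = P' * G) (h' : Q * G' = G' * Q') :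
        P' * (G * Z * G') + (G * Z * G') * Q' = G * Y * G' := by
      rw [hY, mul_add, add_mul, ← mul_assoc G P Z, h, mul_assoc G (Z * Q), mul_assoc Z Q, h']
      simp only [mul_assoc]
    have e₁₁ := block _ _ _ _ hE.mul_lo hF.lo_mul
    have e₁₂ := block _ _ _ _ hE.mul_lo hF.hi_mul
    have e₂₁ := block _ _ _ _ hE.mul_hi hF.lo_mul
    have e₂₂ := block _ _ _ _ hE.mul_hi hF.hi_mul
    have y₁₁ := hE.proj.one_sub.norm_mul_mul_le hF.proj.one_sub Y
    have y₁₂ := hE.proj.one_sub.norm_mul_mul_le hF.proj Y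
    have y₂₁ := hE.proj.norm_mul_mul_le hF.proj.one_sub Y
    have y₂₂ := hE.proj.norm_mul_mul_le hF.proj Y
    have hEE : E * E = E := hE.proj.isIdempotentElem.eq
    have hFF : F * F = F := hF.proj.isIdempotentElem.eq
    have dec : P * Z = (P₁ * ((1 - E) * Z * (1 - F)) + P₂ * (E * Z * F))
        + P₁ * ((1 - E) * Z * F) + P₂ * (E * Z * (1 - F)) := by
      simp only [← mul_assoc, ← hE.mul_lo, ← hE.mul_hi]
      noncomm_ring
    have b₁₁ : ‖P₁ * ((1 - E) * Z * (1 - F))‖ ≤ (3 * n + 1) * ‖Y‖ := by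
      refine (ih hc hP₁ hE.lo_le hQ₁ _).trans ?_
      rw [e₁₁]; gcongr
    have b₂₂ : ‖P₂ * (E * Z * F)‖ ≤ (3 * n + 1) * ‖Y‖ := by
      refine (ih hd hE.le_hi hP₂ hF.le_hi _).trans ?_
      rw [e₂₂]; gcongr
    have hdiag : ‖P₁ * ((1 - E) * Z * (1 - F)) + P₂ * (E * Z * F)‖ ≤ (3 * n + 1) * ‖Y‖ := by
      refine norm_add_le_of_block_diagonal hE.proj hF.proj ?_ ?_ ?_ ?_ b₁₁ b₂₂
      · simp only [← mul_assoc, ← hE.mul_lo]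
        simp [mul_sub, hEE]
      · simp [mul_assoc, sub_mul, hFF]
      · simp only [← mul_assoc, ← hE.mul_hi]
        simp [hEE]
      · simp only [mul_assoc, hFF]
    have b₁₂ : ‖P₁ * ((1 - E) * Z * F)‖ ≤ ‖Y‖ := by
      have h := add_mul_norm_le_norm_mul_add_mul (Z := (1 - E) * Z * F) hP₁ hF.le_hi
      rw [e₁₂] at h
      have hn : ‖P₁‖ ≤ r * c := norm_le_of_nonneg_of_le_smul_one hd.le
        ((smul_nonneg hc.le zero_le_one).trans hP₁) hE.lo_le
      calc _ ≤ ‖P₁‖ * ‖(1 - E) * Z * F‖ := norm_mul_le _ _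
        _ ≤ (c + r * c) * ‖(1 - E) * Z * F‖ := by gcongr; linarith
        _ ≤ ‖Y‖ := h.trans y₁₂
    have b₂₁ : ‖P₂ * (E * Z * (1 - F))‖ ≤ 2 * ‖Y‖ := by
      have h := add_mul_norm_le_norm_mul_add_mul (Z := E * Z * (1 - F)) hE.le_hi hQ₁
      rw [e₂₁] at h
      have hn : ‖Q₁‖ ≤ r * c := norm_le_of_nonneg_of_le_smul_one hd.le
        ((smul_nonneg hc.le zero_le_one).trans hQ₁) hF.lo_le
      have h' : ‖E * Z * (1 - F) * Q₁‖ ≤ ‖Y‖ :=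
        calc _ ≤ ‖E * Z * (1 - F)‖ * ‖Q₁‖ := norm_mul_le _ _
          _ ≤ ‖E * Z * (1 - F)‖ * (r * c + c) := by gcongr; linarith
          _ = (r * c + c) * ‖E * Z * (1 - F)‖ := mul_comm _ _
          _ ≤ ‖Y‖ := h.trans y₂₁
      rw [eq_sub_of_add_eq e₂₁]
      linarith [norm_sub_le (E * Y * (1 - F)) (E * Z * (1 - F) * Q₁)]
    rw [dec]
    refine (norm_add₃_le).trans ?_
    push_cast
    linarith

lemma norm_mul_le_of_norm_sylvester_le (n : ℕ) {a δ : ℝ} (hδ : 0 < δ)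
    (han : a ≤ 2 ^ 2 ^ n * δ) {P Q Z : H →L[ℂ] H} (hP : 0 ≤ P) (hPa : P ≤ a • 1) (hQ : 0 ≤ Q)
    (hZ : ‖Z‖ ≤ 1) (hY : ‖P * Z + Z * Q‖ ≤ δ) : ‖P * Z‖ ≤ (3 * n + 4) * δ := by
  obtain ⟨E, P₁, P₂, hE⟩ := exists_isSpectralSplit (IsSelfAdjoint.of_nonneg hP) δ
  obtain ⟨F, Q₁, Q₂, hF⟩ := exists_isSpectralSplit (IsSelfAdjoint.of_nonneg hQ) δ
  have hM : P ≤ (2 ^ 2 ^ n * δ) • 1 :=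
    hPa.trans (smul_le_smul_of_nonneg_right han zero_le_one)
  have hP₂ := hE.hi_le _ (le_mul_of_one_le_left hδ.le (one_le_pow₀ (by norm_num))) hM
  have lo_norm {P E P₁ P₂ : H →L[ℂ] H} (h : IsSpectralSplit P E P₁ P₂ δ) (h0 : 0 ≤ P) :
      ‖P₁‖ ≤ δ := by
    refine norm_le_of_nonneg_of_le_smul_one hδ.le ?_ h.lo_le
    simpa using h.le_lo 0 hδ.le (by simpa using h0)
  have hP₁ := lo_norm hE hP
  have hQ₁ := lo_norm hF hQ
  set Y := P * Z + Z * Q with hYdef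
  have dec : P * Z = P₁ * ((1 - E) * Z * 1) + (E * Y * (1 - F) - E * Z * (1 - F) * Q₁)
      + P₂ * (E * Z * F) := by
    have e : E * Z * (1 - F) * Q₁ = E * Z * (Q * (1 - F)) := by rw [hF.lo_mul, mul_assoc]
    rw [e, hYdef]
    simp only [← mul_assoc, ← hE.mul_lo, ← hE.mul_hi]
    noncomm_ring
  have b₁ : ‖P₁ * ((1 - E) * Z * 1)‖ ≤ δ :=
    calc _ ≤ ‖P₁‖ * ‖(1 - E) * Z * 1‖ := norm_mul_le _ _
      _ ≤ δ * 1 := by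
        gcongr
        exact (hE.proj.one_sub.norm_mul_mul_le (.one _) Z).trans hZ
      _ = δ := mul_one δ
  have b₂ : ‖E * Z * (1 - F) * Q₁‖ ≤ δ :=
    calc _ ≤ ‖E * Z * (1 - F)‖ * ‖Q₁‖ := norm_mul_le _ _
      _ ≤ 1 * δ := by
        gcongr
        exact (hE.proj.norm_mul_mul_le hF.proj.one_sub Z).trans hZ
      _ = δ := one_mul δ
  have b₃ : ‖P₂ * (E * Z * F)‖ ≤ (3 * n + 1) * δ := by
    refine (norm_mul_le_of_sylvester n hδ hE.le_hi hP₂ hF.le_hi _).trans ?_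
    have e : P₂ * (E * Z * F) + E * Z * F * Q₂ = E * Y * F := by
      rw [hYdef, mul_add, add_mul, ← mul_assoc E P Z, hE.mul_hi, mul_assoc E (Z * Q),
        mul_assoc Z Q, hF.hi_mul]
      simp only [mul_assoc]
    rw [e]
    gcongr
    exact (hE.proj.norm_mul_mul_le hF.proj Y).trans hY
  have b₄ := (hE.proj.norm_mul_mul_le hF.proj.one_sub Y).trans hY
  rw [dec]
  refine (norm_add₃_le).trans ?_
  linarith [norm_sub_le (E * Y * (1 - F)) (E * Z * (1 - F) * Q₁)]

lemma norm_posPart_mul_le (n : ℕ) {a δ : ℝ} (hδ : 0 < δ)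
    (han : a ≤ 2 ^ 2 ^ n * δ) {A B E F : H →L[ℂ] H} (hA : IsSelfAdjoint A)
    (hB : IsSelfAdjoint B) (hAa : A⁺ ≤ a • 1) (hAB : ‖A - B‖ ≤ δ)
    (hE : IsStarProjection E) (hF : IsStarProjection F) (hEA : E * A⁺ = A⁺)
    (hAE : A⁺ * E = A⁺) (hEA' : E * A⁻ = 0) (hBF : B⁺ * F = B⁺) (hBF' : B⁻ * F = 0) :
    ‖A⁺ * (1 - F)‖ ≤ (3 * n + 4) * δ := by
  have e : A⁺ * (1 - F) = A⁺ * (E * 1 * (1 - F)) := by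
    rw [mul_one, ← mul_assoc, hAE]
  rw [e]
  refine norm_mul_le_of_norm_sylvester_le n hδ han (CFC.posPart_nonneg A) hAa
    (CFC.negPart_nonneg B) ?_ ?_
  · exact (hE.norm_mul_mul_le hF.one_sub 1).trans (IsStarProjection.one _).norm_le
  · have e' : A⁺ * (E * 1 * (1 - F)) + E * 1 * (1 - F) * B⁻ = E * (A - B) * (1 - F) := by
      have hFB : F * B⁻ = 0 := by
        have := congrArg star hBF'
        rwa [star_mul, hF.isSelfAdjoint.star_eq,
          (IsSelfAdjoint.of_nonneg (CFC.negPart_nonneg B)).star_eq, star_zero] at this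
      have hD : E * (A - B) * (1 - F) = (E * A⁺ - E * A⁻ - E * B⁺ + E * B⁻) * (1 - F) := by
        nth_rw 1 [← CFC.posPart_sub_negPart A hA, ← CFC.posPart_sub_negPart B hB]
        noncomm_ring
      rw [hD, hEA, hEA']
      simp only [mul_sub, sub_mul, add_mul, mul_one, mul_assoc, hFB, hBF, hBF', mul_zero,
        ← mul_assoc A⁺ E, hAE, zero_mul]
      abel
    rw [e']
    exact (hE.norm_mul_mul_le hF.one_sub _).trans hAB

lemma norm_posPart_sub_posPart_le (n : ℕ) {a δ : ℝ} (hδ : 0 < δ)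
    (han : a ≤ 2 ^ 2 ^ n * δ) {A B : H →L[ℂ] H} (hA : IsSelfAdjoint A) (hB : IsSelfAdjoint B)
    (hAa : A⁺ ≤ a • 1) (hBa : B⁺ ≤ a • 1) (hAB : ‖A - B‖ ≤ δ) :
    ‖A⁺ - B⁺‖ ≤ (6 * n + 9) * δ := by
  obtain ⟨E, hE, e1, e2, e3, e4⟩ := exists_isStarProjection_posPart A
  obtain ⟨F, hF, f1, f2, f3, f4⟩ := exists_isStarProjection_posPart B
  have h1 := norm_posPart_mul_le n hδ han hA hB hAa hAB hE hF e1 e2 e3 f2 f4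
  have h2 := norm_posPart_mul_le n hδ han hB hA hBa (by rwa [norm_sub_rev]) hF hE f1 f2 f3 e2 e4
  have h3 := (hE.norm_mul_mul_le hF (A - B)).trans hAB
  have h4 : ‖(1 - E) * B⁺‖ = ‖B⁺ * (1 - E)‖ := by
    rw [← norm_star, star_mul, hE.one_sub.isSelfAdjoint.star_eq,
      (IsSelfAdjoint.of_nonneg (CFC.posPart_nonneg B)).star_eq]
  have e : A⁺ - B⁺ = E * (A - B) * F + A⁺ * (1 - F) - (1 - E) * B⁺ := by
    have : E * (A - B) * F = A⁺ * F - E * B⁺ := by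
      nth_rw 1 [← CFC.posPart_sub_negPart A hA, ← CFC.posPart_sub_negPart B hB]
      simp only [mul_sub, sub_mul, mul_assoc, f2, f4, mul_zero]
      simp only [← mul_assoc, e1, e3, zero_mul]
      abel
    rw [this]
    noncomm_ring
  rw [e]
  linarith [norm_sub_le (E * (A - B) * F + A⁺ * (1 - F)) ((1 - E) * B⁺),
    norm_add_le (E * (A - B) * F) (A⁺ * (1 - F))]

lemma negPart_le_of_spectrum_subset {A : H →L[ℂ] H} (hA : IsSelfAdjoint A) {a : ℝ}
    (ha : 0 ≤ a) (h : spectrum ℝ A ⊆ Set.Ici (-a)) : A⁻ ≤ a • 1 := by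
  rw [CFC.negPart_def, cfcₙ_eq_cfc, ← Algebra.algebraMap_eq_smul_one]
  refine cfc_le_algebraMap _ _ _ fun x hx => ?_
  have := h hx
  simp only [Set.mem_Ici] at this
  exact max_le (by linarith) ha

end Hilbert

lemma opAbs_eq_add {H : Type} [NormedAddCommGroup H] [InnerProductSpace ℂ H]
    [CompleteSpace H] {A : H →L[ℂ] H} (hA : IsSelfAdjoint A) : opAbs A = A + 2 • A⁻ := by
  rw [← CFC.abs_sub_self A hA, add_sub_cancel, opAbs, CFC.abs,
    CFC.sqrt_eq_real_sqrt _ (star_mul_self_nonneg A), cfcₙ_eq_cfc]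

lemma exists_le_two_pow_two_pow {x : ℝ} (hx : 0 < x) :
    ∃ n : ℕ, x ≤ 2 ^ 2 ^ n ∧ (n : ℝ) ≤ 6 * Real.log (2 + max (Real.log x) 0) := by
  set L := max (Real.log x) 0 with hL
  have hL0 : 0 ≤ L := le_max_right _ _
  have h2 : 1 / 2 < Real.log 2 := by linarith [Real.log_two_gt_d9]
  have hlog : Real.log 2 ≤ Real.log (2 + L) := Real.log_le_log (by norm_num) (by linarith)
  refine ⟨⌈4 * Real.log (2 + L)⌉₊, ?_, ?_⟩
  · set n := ⌈4 * Real.log (2 + L)⌉₊ with hn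
    have hn1 : 4 * Real.log (2 + L) ≤ n := Nat.le_ceil _
    have h3 : (2 + L) ^ 2 ≤ (2 : ℝ) ^ n := by
      rw [← Real.log_le_log_iff (by positivity) (by positivity), Real.log_pow, Real.log_pow]
      push_cast
      nlinarith
    rw [← Real.log_le_log_iff hx (by positivity), Real.log_pow]
    push_cast
    have h4 : Real.log x ≤ L := le_max_left _ _
    nlinarith
  · have := Nat.ceil_lt_add_one (a := 4 * Real.log (2 + L)) (by linarith)
    linarith

theorem stmt1 :
    ∃ C : ℝ, 0 < C ∧
      ∀ (H : Type) [NormedAddCommGroup H] [InnerProductSpace ℂ H] [CompleteSpace H]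
        (a δ : ℝ), 0 < a → 0 < δ →
        ∀ A B : H →L[ℂ] H, IsSelfAdjoint A → IsSelfAdjoint B →
          spectrum ℝ A ⊆ Set.Ici (-a) → spectrum ℝ B ⊆ Set.Ici (-a) →
          ‖A - B‖ ≤ δ →
          ‖opAbs A - opAbs B‖ ≤ C * δ * Real.log (2 + max (Real.log (a / δ)) 0) := by
  refine ⟨110, by norm_num, ?_⟩
  intro H _ _ _ a δ ha hδ A B hA hB hsA hsB hAB
  obtain ⟨n, hn, hnL⟩ := exists_le_two_pow_two_pow (div_pos ha hδ)
  have hneg : ‖A⁻ - B⁻‖ ≤ (6 * n + 9) * δ := by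
    rw [← CFC.posPart_neg A, ← CFC.posPart_neg B]
    refine norm_posPart_sub_posPart_le n hδ ((div_le_iff₀ hδ).1 hn) hA.neg hB.neg ?_ ?_ ?_
    · rw [CFC.posPart_neg]; exact negPart_le_of_spectrum_subset hA ha.le hsA
    · rw [CFC.posPart_neg]; exact negPart_le_of_spectrum_subset hB ha.le hsB
    · rwa [neg_sub_neg, norm_sub_rev]
  have h1 : ‖opAbs A - opAbs B‖ ≤ δ + 2 * ((6 * n + 9) * δ) := by
    have e : opAbs A - opAbs B = (A - B) + 2 • (A⁻ - B⁻) := by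
      rw [opAbs_eq_add hA, opAbs_eq_add hB, smul_sub]; abel
    rw [e]
    refine (norm_add_le _ _).trans (add_le_add hAB ((norm_nsmul_le).trans ?_))
    push_cast
    gcongr
  have hlog : Real.log 2 ≤ Real.log (2 + max (Real.log (a / δ)) 0) :=
    Real.log_le_log (by norm_num) (by linarith [le_max_right (Real.log (a / δ)) 0])
  have h2 : 1 / 2 < Real.log 2 := by linarith [Real.log_two_gt_d9]
  calc _ ≤ δ * (12 * n + 19) := by linarith
    _ ≤ δ * (110 * Real.log (2 + max (Real.log (a / δ)) 0)) := by gcongr; linarith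
    _ = _ := by ring
end

section
/- There exists a constant c > 0 such that for every a > 0 and every δ with 0 < δ < a, there exist bounded self-adjoint operators A, B on the Hilbert space ℓ²(ℕ, ℂ) with spectra contained in [−a, a], with 0 < ‖A − B‖ ≤ δ, and with ‖ |A| − |B| ‖ ≥ c · δ · log(2 + log(a/δ)). -/
open MeasureTheory ENNReal

open scoped Matrix.Norms.L2Operator

theorem sum_mul_pow_mul_sub_one (w : ℂ) (n : ℕ) : (∑ k ∈ Finset.range n, (k:ℂ) * w ^ k) * (w - 1) =
    n * w ^ n - w * ∑ k ∈ Finset.range n, w ^ k := by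
  induction n with
  | zero => simp
  | succ n ih => rw [Finset.sum_range_succ, Finset.sum_range_succ, add_mul, ih]; push_cast; ring

theorem exists_unitary_norm_sub_conj {E : Type*} [CStarAlgebra E] (K : E) (hK : IsSelfAdjoint K) (hK1 : ‖K‖ ≤ 1) :
    ∃ U ∈ unitary E, ∀ A : E, ‖A - U * A * star U‖ ≤ 2 * ‖K * A - A * K‖ ∧
      ‖K * A - A * K‖ ≤ 2 * ‖A - U * A * star U‖ := by
  rcases subsingleton_or_nontrivial E with h | h
  · exact ⟨1, one_mem _, fun A => by simp [Subsingleton.elim _ (0 : E)]⟩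
  set G : E := 1 - Complex.I • K with hG
  have hGu : IsUnit G := by
    have h1 : -Complex.I ∉ spectrum ℂ K := fun hm => by
      have := hK.mem_spectrum_eq_re hm
      simpa using congrArg Complex.im this
    rw [spectrum.notMem_iff] at h1
    have h2 : G = algebraMap ℂ E Complex.I * (algebraMap ℂ E (-Complex.I) - K) := by
      rw [mul_sub, ← map_mul, ← Algebra.smul_def]; simp [hG]
    rw [h2]
    exact ((isUnit_iff_ne_zero.2 Complex.I_ne_zero).map _).mul h1
  have hsG : star G = 2 - G := by
    simp only [hG, star_sub, star_one, star_smul, hK.star_eq, Complex.star_def, Complex.conj_I, neg_smul]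
    rw [← one_add_one_eq_two]; abel
  obtain ⟨g, hg⟩ := hGu
  set R : E := ↑g⁻¹ with hR
  have hGR : G * R = 1 := by rw [← hg, hR]; simp
  have hRG : R * G = 1 := by rw [← hg, hR]; simp
  have hsRG : star R * star G = 1 := by rw [← star_mul, hGR, star_one]
  have hsGR : star G * star R = 1 := by rw [← star_mul, hRG, star_one]
  set U : E := 2 * R - 1 with hU
  have hU1 : U = star G * R := by rw [hsG, sub_mul, hGR]
  have hU2 : U = R * star G := by rw [hsG, mul_sub, hRG, hU, mul_two, two_mul]
  have hsU : star U = G * star R := by rw [hU2, star_mul, star_star]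
  have hsU' : star U = star R * G := by rw [hU1, star_mul, star_star]
  have hUm : U ∈ unitary E := by
    refine Unitary.mem_iff.2 ⟨?_, ?_⟩
    · rw [hsU', hU2, mul_assoc, ← mul_assoc G, hGR, one_mul, hsRG]
    · rw [hsU', hU2, mul_assoc, ← mul_assoc (star G), hsGR, one_mul, hRG]
  refine ⟨U, hUm, fun A => ?_⟩
  have e1 : ‖A - U * A * star U‖ = ‖A * U - U * A‖ := by
    rw [← CStarRing.norm_mul_mem_unitary (A - U * A * star U) hUm, sub_mul, mul_assoc (U * A),
      (Unitary.mem_iff.1 hUm).1, mul_one]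
  have hRn : ‖R‖ ≤ 1 := by
    have : R = (1/2 : ℂ) • (U + 1) := by
      rw [hU, sub_add_cancel, two_mul, ← two_smul ℂ R, smul_smul]
      norm_num
    rw [this, norm_smul]
    have h3 := norm_add_le U 1
    rw [CStarRing.norm_of_mem_unitary hUm, norm_one] at h3
    norm_num; linarith
  have hGn : ‖G‖ ≤ 2 := by
    have h3 := norm_sub_le (1:E) (Complex.I • K)
    rw [norm_smul, norm_one] at h3
    simp only [Complex.norm_I, one_mul] at h3
    linarith
  have e2 : G * (A * U - U * A) * G = (2 * Complex.I) • (A * K - K * A) := by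
    have h6 : G * (A * U - U * A) * G = 2 * (G * A * (R * G) - (G * R) * A * G) := by
      rw [hU]; noncomm_ring
    rw [h6, hRG, hGR, hG, two_mul, ← two_smul ℂ, mul_smul]
    congr 1
    simp only [sub_mul, mul_sub, one_mul, mul_one, smul_mul_assoc, mul_smul_comm, smul_sub]
    abel
  have e3 : A * U - U * A = R * ((2 * Complex.I) • (A * K - K * A)) * R := by
    rw [← e2]
    simp only [← mul_assoc, hRG, one_mul]; rw [mul_assoc, hGR, mul_one]
  have e4 : ‖(2 * Complex.I) • (A * K - K * A)‖ = 2 * ‖K * A - A * K‖ := by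
    rw [norm_smul, norm_sub_rev]; simp
  rw [e1]
  constructor
  · rw [e3, ← e4]
    refine (norm_mul_le _ _).trans ((mul_le_mul (norm_mul_le _ _) hRn (norm_nonneg _) (by positivity)).trans ?_)
    rw [mul_one]
    exact mul_le_of_le_one_left (norm_nonneg _) hRn
  · have h5 : ‖G * (A * U - U * A) * G‖ ≤ 2 * ‖A * U - U * A‖ * 2 := by
      refine (norm_mul_le _ _).trans (mul_le_mul ((norm_mul_le _ _).trans ?_) hGn (norm_nonneg _) (by positivity))
      gcongr
    rw [e2, e4] at h5
    linarith

theorem exists_skewAdjoint_circulant (N : ℕ) (hN : 0 < N) : ∃ X : Matrix (Fin N) (Fin N) ℂ, star X = -X ∧ ‖X‖ ≤ 1 ∧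
    (∀ i, X i i = 0) ∧ ∀ i j : Fin N, i ≠ j → X i j =
      2 * Complex.I / (N * (Complex.exp (((2 * Real.pi * ((i : ℝ) - j) / N : ℝ) : ℂ) * Complex.I) - 1)) := by
  have hN0 : (N : ℝ) ≠ 0 := by positivity
  have hNc : (N : ℂ) ≠ 0 := by exact_mod_cast hN.ne'
  let w (i j : Fin N) : ℂ := Complex.exp (((2 * Real.pi * ((i : ℝ) - j) / N : ℝ) : ℂ) * Complex.I)
  let F : Matrix (Fin N) (Fin N) ℂ := fun j k =>
    Complex.exp (((2 * Real.pi * (j : ℝ) / N : ℝ) : ℂ) * Complex.I) ^ (k : ℕ)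
  let ε : Fin N → ℂ := fun k => (((2 * (k : ℝ) + 1 - N) / N : ℝ) : ℂ)
  have hw (i j k : Fin N) : F i k * star (F j k) = w i j ^ (k : ℕ) := by
    simp only [F, w, star_pow, ← mul_pow, Complex.star_def, ← Complex.exp_conj, ← Complex.exp_add]
    congr 2
    simp only [map_mul, Complex.conj_ofReal, Complex.conj_I]
    push_cast
    ring
  have hw1 (i : Fin N) : w i i = 1 := by simp [w]
  have hwN (i j : Fin N) : w i j ^ N = 1 := by
    simp only [w, ← Complex.exp_nat_mul]
    rw [Complex.exp_eq_one_iff]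
    refine ⟨(i : ℤ) - j, ?_⟩
    push_cast
    field_simp
  have hwne (i j : Fin N) (hij : i ≠ j) : w i j ≠ 1 := by
    intro h
    rw [Complex.exp_eq_one_iff] at h
    obtain ⟨n, hn⟩ := h
    have h2 : (((i : ℤ) - (j : ℤ) : ℤ) : ℂ) = ((n * N : ℤ) : ℂ) := by
      push_cast at hn ⊢
      have hpi : (Real.pi : ℂ) ≠ 0 := by exact_mod_cast Real.pi_ne_zero
      field_simp at hn
      linear_combination hn
    have h3 : (i : ℤ) - (j : ℤ) = n * N := by exact_mod_cast h2
    have h4 : n = 0 := by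
      have := i.2; have := j.2
      by_contra hn0
      rcases lt_or_gt_of_ne hn0 with h | h <;> nlinarith
    apply hij; ext; subst h4; omega
  have hgeom (i j : Fin N) (hij : i ≠ j) : ∑ k ∈ Finset.range N, w i j ^ k = 0 := by
    rw [geom_sum_eq (hwne i j hij), hwN]; simp
  have hFF : F * star F = (N : ℂ) • (1 : Matrix (Fin N) (Fin N) ℂ) := by
    ext i j
    rw [Matrix.mul_apply, Matrix.smul_apply, Matrix.one_apply]
    simp only [Matrix.star_apply, hw]
    rw [Fin.sum_univ_eq_sum_range (fun k => w i j ^ k)]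
    split_ifs with h
    · subst h; simp [hw1]
    · rw [hgeom i j h]; simp
  have hFn : ‖F‖ * ‖F‖ ≤ N := by
    rw [← CStarRing.norm_self_mul_star, hFF, norm_smul]
    have : Nonempty (Fin N) := ⟨⟨0, hN⟩⟩
    simp
  have hε : ‖ε‖ ≤ 1 := by
    rw [pi_norm_le_iff_of_nonneg zero_le_one]
    intro k
    simp only [ε]
    rw [Complex.norm_real, Real.norm_eq_abs, abs_div, abs_of_pos (by positivity : (0:ℝ) < N),
      div_le_one (by positivity), abs_le]
    have : ((k : ℕ) : ℝ) + 1 ≤ N := by exact_mod_cast k.2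
    constructor <;> linarith [(k : ℕ).cast_nonneg (α := ℝ)]
  have hX (i j : Fin N) : ((Complex.I / N) • (F * Matrix.diagonal ε * star F)) i j =
      Complex.I / N * (2 / N * (∑ k ∈ Finset.range N, (k : ℂ) * w i j ^ k)
        + (1 - N) / N * ∑ k ∈ Finset.range N, w i j ^ k) := by
    rw [Matrix.smul_apply, Matrix.mul_apply, smul_eq_mul, Finset.mul_sum _ _ (2 / (N : ℂ)),
      Finset.mul_sum _ _ ((1 - N) / (N : ℂ)), ← Finset.sum_add_distrib,
      ← Fin.sum_univ_eq_sum_range (fun k => 2 / (N:ℂ) * ((k : ℂ) * w i j ^ k) + (1 - N) / N * w i j ^ k)]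
    congr 1
    refine Finset.sum_congr rfl fun k _ => ?_
    rw [Matrix.mul_diagonal, Matrix.star_apply, mul_right_comm, hw]
    simp only [ε]
    push_cast
    ring
  refine ⟨(Complex.I / N) • (F * Matrix.diagonal ε * star F), ?_, ?_, ?_, ?_⟩
  · have h1 : star (Matrix.diagonal ε) = Matrix.diagonal ε := by
      rw [Matrix.star_eq_conjTranspose, Matrix.diagonal_conjTranspose]
      congr 1; ext k; simp [ε]
    rw [star_smul, star_mul, star_mul, star_star, h1, ← mul_assoc, ← neg_smul]
    congr 1
    simp [neg_div]
  · have h2 : ‖F * Matrix.diagonal ε * star F‖ ≤ N := by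
      refine (norm_mul_le _ _).trans ?_
      rw [norm_star]
      refine le_trans (mul_le_mul_of_nonneg_right ((norm_mul_le _ _).trans ?_) (norm_nonneg _)) hFn
      rw [Matrix.l2_opNorm_diagonal]
      exact mul_le_of_le_one_right (norm_nonneg _) hε
    rw [norm_smul]
    simp only [norm_div, Complex.norm_I, Complex.norm_natCast]
    rw [one_div, inv_mul_le_one₀ (by positivity)]
    exact h2
  · intro i
    rw [hX, hw1]
    have h3 : ∀ n : ℕ, 2 * ∑ k ∈ Finset.range n, (k : ℂ) = n * (n - 1) := by
      intro n
      induction n with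
      | zero => simp
      | succ n ih => rw [Finset.sum_range_succ, mul_add, ih]; push_cast; ring
    simp only [one_pow, mul_one, Finset.sum_const, Finset.card_range, nsmul_eq_mul]
    have := h3 N
    field_simp
    linear_combination Complex.I * this
  · intro i j hij
    have h4 := sum_mul_pow_mul_sub_one (w i j) N
    rw [hX, hgeom i j hij]
    rw [hgeom i j hij, hwN] at h4
    have h5 : w i j - 1 ≠ 0 := sub_ne_zero.2 (hwne i j hij)
    change _ = 2 * Complex.I / (N * (w i j - 1))
    rw [eq_div_iff (mul_ne_zero hNc h5)]
    field_simp
    linear_combination 2 * h4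

theorem norm_sum_entries_le {N p : ℕ} (X : Matrix (Fin N) (Fin N) ℂ) (f g : Fin p → Fin N)
    (hf : Function.Injective f) (hg : Function.Injective g) :
    ‖∑ a, ∑ b, X (f a) (g b)‖ ≤ p * ‖X‖ := by
  have key (f : Fin p → Fin N) (hf : Function.Injective f) :
      ‖∑ a, EuclideanSpace.single (f a) (1 : ℂ)‖ * ‖∑ a, EuclideanSpace.single (f a) (1 : ℂ)‖ = p := by
    have ho := ((EuclideanSpace.basisFun (Fin N) ℂ).orthonormal.comp f hf)
    have := ho.inner_sum (fun _ => 1) (fun _ => 1) Finset.univ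
    rw [← sq, ← @inner_self_eq_norm_sq ℂ]
    simp at this
    simp [this]
  set u := ∑ a, EuclideanSpace.single (f a) (1 : ℂ)
  set v := ∑ a, EuclideanSpace.single (g a) (1 : ℂ)
  have h1 : ∑ a, ∑ b, X (f a) (g b) = inner ℂ u (Matrix.toEuclideanCLM (𝕜 := ℂ) X v) := by
    simp only [u, v, map_sum, sum_inner, inner_sum]
    rw [Finset.sum_comm]
    refine Finset.sum_congr rfl fun b _ => Finset.sum_congr rfl fun a _ => ?_
    rw [EuclideanSpace.inner_single_left]
    simp [Matrix.ofLp_toEuclideanCLM]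
  have h2 : ‖u‖ = √p := by rw [← key f hf, Real.sqrt_mul_self (norm_nonneg _)]
  have h3 : ‖v‖ = √p := by rw [← key g hg, Real.sqrt_mul_self (norm_nonneg _)]
  rw [h1]
  refine (norm_inner_le_norm _ _).trans ?_
  refine (mul_le_mul_of_nonneg_left ((Matrix.toEuclideanCLM (𝕜 := ℂ) X).le_opNorm v) (norm_nonneg _)).trans ?_
  rw [Matrix.l2_opNorm_toEuclideanCLM, h2, h3]
  rw [mul_left_comm, Real.mul_self_sqrt (Nat.cast_nonneg p), mul_comm]

theorem norm_entry_le {N : ℕ} (X : Matrix (Fin N) (Fin N) ℂ) (i j : Fin N) : ‖X i j‖ ≤ ‖X‖ := by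
  simpa using norm_sum_entries_le (p := 1) X (fun _ => i) (fun _ => j) (Function.injective_of_subsingleton _)
    (Function.injective_of_subsingleton _)

theorem norm_le_of_entry_le {N : ℕ} (X : Matrix (Fin N) (Fin N) ℂ) (c : ℝ)
    (h : ∀ i j, ‖X i j‖ ≤ c) : ‖X‖ ≤ (N : ℝ) ^ 2 * c := by
  have hs (i j : Fin N) (z : ℂ) : ‖Matrix.single i j z‖ ≤ ‖z‖ := by
    have h0 : star (Matrix.single i j z) * Matrix.single i j z = Matrix.diagonal (Pi.single j (star z * z)) := by
      rw [Matrix.star_eq_conjTranspose, Matrix.conjTranspose_single, Matrix.single_mul_single_same, Matrix.diagonal_single]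
    have h1 : ‖Matrix.single i j z‖ * ‖Matrix.single i j z‖ = ‖z‖ * ‖z‖ := by
      rw [← CStarRing.norm_star_mul_self, h0, Matrix.l2_opNorm_diagonal, Pi.norm_single]; simp
    exact (mul_self_inj_of_nonneg (norm_nonneg _) (norm_nonneg _)|>.1 h1).le
  rw [Matrix.matrix_eq_sum_single X]
  refine (norm_sum_le _ _).trans ?_
  refine (Finset.sum_le_sum fun i _ => (norm_sum_le _ _).trans (Finset.sum_le_sum fun j _ => (hs i j _).trans (h i j))).trans ?_
  simp; apply le_of_eq; ring

theorem re_symbol (N : ℕ) (θ : ℝ) :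
    (2 * Complex.I / (N * (Complex.exp ((θ : ℂ) * Complex.I) - 1))).re =
      Real.sin θ / (N * (1 - Real.cos θ)) := by
  have h1 : Complex.exp ((θ : ℂ) * Complex.I) - 1 = ⟨Real.cos θ - 1, Real.sin θ⟩ := by
    apply Complex.ext <;> simp [Complex.exp_ofReal_mul_I_re, Complex.exp_ofReal_mul_I_im]
  have h2 : (2 * Complex.I / (N * (Complex.exp ((θ : ℂ) * Complex.I) - 1))) =
      ((2 / N : ℝ) : ℂ) * (Complex.I / (Complex.exp ((θ : ℂ) * Complex.I) - 1)) := by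
    push_cast; rw [mul_div_mul_comm]
  rw [h2, Complex.re_ofReal_mul, h1, Complex.div_re, Complex.normSq_mk]
  simp only [Complex.I_re, Complex.I_im]
  have h3 : (Real.cos θ - 1) * (Real.cos θ - 1) + Real.sin θ * Real.sin θ = 2 * (1 - Real.cos θ) := by
    nlinarith [Real.sin_sq_add_cos_sq θ]
  rw [h3, zero_mul, zero_div, zero_add, one_mul, mul_comm (N : ℝ), ← div_div _ _ (N : ℝ),
    mul_comm (2 : ℝ), ← div_div]
  ring

theorem symbol_lower (N : ℕ) (hN : 0 < N) (m : ℝ) (hm : 0 < m) (hmN : 4 * m ≤ N) :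
    1 / (5 * m) ≤ Real.sin (2 * Real.pi * m / N) / (N * (1 - Real.cos (2 * Real.pi * m / N))) := by
  have hpi := Real.pi_pos
  have hN' : (0 : ℝ) < N := by exact_mod_cast hN
  set θ := 2 * Real.pi * m / N with hθ
  have hθ0 : 0 < θ := by positivity
  have hθN : θ * N = 2 * Real.pi * m := by rw [hθ]; field_simp
  have hθ1 : θ ≤ Real.pi / 2 := by
    rw [hθ, div_le_iff₀ hN']; nlinarith
  have h1 := Real.mul_le_sin hθ0.le hθ1
  have h2 : 1 - Real.cos θ ≤ θ ^ 2 / 2 := by linarith [Real.one_sub_sq_div_two_le_cos (x := θ)]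
  have h3 : 0 < 1 - Real.cos θ := by
    have := Real.sin_pos_of_pos_of_lt_pi hθ0 (by linarith)
    nlinarith [Real.sin_sq_add_cos_sq θ]
  have hpi2 : Real.pi ^ 2 ≤ 10 := by nlinarith [Real.pi_lt_d2]
  rw [div_le_div_iff₀ (by positivity) (by positivity)]
  have h4 : Real.pi * (2 / Real.pi * θ) = 2 * θ := by field_simp
  have h5 : 2 * θ ≤ Real.pi * Real.sin θ := by rw [← h4]; gcongr
  calc 1 * (N * (1 - Real.cos θ)) ≤ N * (θ ^ 2 / 2) := by rw [one_mul]; gcongr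
    _ = θ * Real.pi * m := by linear_combination θ / 2 * hθN
    _ ≤ Real.sin θ * (5 * m) := by
      have : θ * Real.pi ≤ 5 * Real.sin θ := by
        have := mul_le_mul_of_nonneg_left h5 hpi.le
        have h6 : 0 ≤ Real.sin θ := by nlinarith
        nlinarith
      nlinarith

theorem ratio_lower {i j : ℕ} (h : j < i) : (1 : ℝ) / 3 ≤ ((2:ℝ) ^ i - 2 ^ j) / (2 ^ i + 2 ^ j) := by
  have h1 : (2:ℝ) ^ (j + 1) ≤ 2 ^ i := pow_le_pow_right₀ (by norm_num) h
  have h2 : (0:ℝ) < 2 ^ j := by positivity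
  rw [pow_succ] at h1
  rw [div_le_div_iff₀ (by norm_num) (by positivity)]
  linarith

theorem ratio_mul_symbol_lower_of_lt (N : ℕ) {i j : ℕ} (h : j < i) (hN : 4 * (i - j : ℝ) ≤ N) :
    1 / (15 * (i - j : ℝ)) ≤ ((2:ℝ) ^ i - 2 ^ j) / (2 ^ i + 2 ^ j) *
      (Real.sin (2 * Real.pi * ((i : ℝ) - j) / N) / (N * (1 - Real.cos (2 * Real.pi * ((i : ℝ) - j) / N)))) := by
  have h0 : (0 : ℝ) < (i : ℝ) - j := by rw [sub_pos]; exact_mod_cast h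
  have hN0 : 0 < N := by
    have : (0 : ℝ) < N := by linarith
    exact_mod_cast this
  refine le_trans (le_of_eq ?_) (mul_le_mul (ratio_lower h) (symbol_lower N hN0 _ h0 hN) (by positivity)
    (le_trans (by norm_num) (ratio_lower h)))
  field_simp; norm_num

theorem ratio_mul_symbol_lower (N : ℕ) {i j : ℕ} (h : i ≠ j) (hN : 4 * |(i - j : ℝ)| ≤ N) :
    1 / (15 * |(i - j : ℝ)|) ≤ ((2:ℝ) ^ i - 2 ^ j) / (2 ^ i + 2 ^ j) *
      (Real.sin (2 * Real.pi * ((i : ℝ) - j) / N) / (N * (1 - Real.cos (2 * Real.pi * ((i : ℝ) - j) / N)))) := by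
  rcases lt_or_gt_of_ne h with h | h
  · have h0 : (0 : ℝ) < (j : ℝ) - i := by rw [sub_pos]; exact_mod_cast h
    rw [abs_sub_comm, abs_of_pos h0] at *
    refine (ratio_mul_symbol_lower_of_lt N h hN).trans (le_of_eq ?_)
    have e : 2 * Real.pi * ((i : ℝ) - j) / N = - (2 * Real.pi * ((j : ℝ) - i) / N) := by ring
    rw [e, Real.sin_neg, Real.cos_neg, add_comm ((2:ℝ)^i)]
    ring
  · have h0 : (0 : ℝ) < (i : ℝ) - j := by rw [sub_pos]; exact_mod_cast h
    rw [abs_of_pos h0] at *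
    exact ratio_mul_symbol_lower_of_lt N h hN

theorem log_le_row_sum (p a : ℕ) (ha : a ≤ p) :
    Real.log (p + 1) / 2 ≤ ∑ b ∈ Finset.range p, 1 / |((2 * a : ℕ) : ℝ) - ((2 * b + 1 : ℕ) : ℝ)| := by
  have h1 : Real.log (p + 1) / 2 ≤ ∑ b ∈ Finset.range p, 1 / (2 * (b : ℝ) + 1) := by
    have h := log_add_one_le_harmonic p
    rw [harmonic] at h
    push_cast at h
    have h2 : (∑ b ∈ Finset.range p, ((b : ℝ) + 1)⁻¹) / 2 ≤ ∑ b ∈ Finset.range p, 1 / (2 * (b : ℝ) + 1) := by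
      rw [Finset.sum_div]
      refine Finset.sum_le_sum fun b _ => ?_
      rw [inv_eq_one_div, div_div]
      apply one_div_le_one_div_of_le <;> [positivity; linarith]
    linarith
  refine h1.trans ?_
  rw [← Finset.sum_range_add_sum_Ico _ ha, ← Finset.sum_range_add_sum_Ico _ ha]
  refine add_le_add ?_ ?_
  · rw [← Finset.sum_range_reflect]
    refine Finset.sum_le_sum fun b hb => ?_
    have hb := Finset.mem_range.1 hb
    apply le_of_eq
    congr 1
    rw [show a - 1 - b = a - (1 + b) by omega, Nat.cast_sub (by omega)]
    push_cast
    have : (b : ℝ) + 1 ≤ a := by exact_mod_cast hb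
    rw [abs_of_pos] <;> linarith
  · refine Finset.sum_le_sum fun b hb => ?_
    have hb := (Finset.mem_Ico.1 hb).1
    have hb' : (a : ℝ) ≤ b := by exact_mod_cast hb
    push_cast
    have ha0 : (0 : ℝ) ≤ a := by positivity
    rw [abs_of_neg (by linarith)]
    apply one_div_le_one_div_of_le <;> linarith

theorem exists_commutator_lower_bound (p : ℕ) (hp : 0 < p) :
    ∃ (K : Matrix (Fin (8 * p)) (Fin (8 * p)) ℂ) (l : Fin (8 * p) → ℝ),
      IsSelfAdjoint K ∧ ‖K‖ ≤ 1 ∧ (∀ i, |l i| ≤ 8 ^ (8 * p)) ∧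
      ‖K * Matrix.diagonal (fun i => (l i : ℂ)) - Matrix.diagonal (fun i => (l i : ℂ)) * K‖ ≤ 1 ∧
      Real.log (p + 1) / 30 ≤
        ‖K * Matrix.diagonal (fun i => ((|l i| : ℝ) : ℂ)) - Matrix.diagonal (fun i => ((|l i| : ℝ) : ℂ)) * K‖ := by
  obtain ⟨N, hN⟩ : ∃ N, N = 8 * p := ⟨_, rfl⟩
  rw [← hN]
  have hN0 : 0 < N := by omega
  have hNr : (0 : ℝ) < N := by exact_mod_cast hN0
  obtain ⟨X, hXs, hX1, hXd, hX⟩ := exists_skewAdjoint_circulant N hN0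
  let l : Fin N → ℝ := fun i => (N : ℝ) ^ 2 * (((-2 : ℤ) ^ (i : ℕ) : ℤ) : ℝ)
  have hla (i : Fin N) : |l i| = (N : ℝ) ^ 2 * 2 ^ (i : ℕ) := by
    simp [l, abs_mul]
  have hl (i j : Fin N) (hij : i ≠ j) : (N : ℝ) ^ 2 ≤ |l i - l j| := by
    have h0 : (-2 : ℤ) ^ (i : ℕ) - (-2) ^ (j : ℕ) ≠ 0 := by
      intro h
      have h1 := congrArg Int.natAbs (sub_eq_zero.1 h)
      rw [Int.natAbs_pow, Int.natAbs_pow] at h1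
      exact hij (Fin.ext (Nat.pow_right_injective le_rfl h1))
    have h2 : (1 : ℝ) ≤ |(((-2 : ℤ) ^ (i : ℕ) - (-2) ^ (j : ℕ) : ℤ) : ℝ)| := by
      exact_mod_cast Int.one_le_abs h0
    simp only [l]
    rw [← mul_sub, abs_mul, abs_of_pos (by positivity : (0 : ℝ) < (N : ℝ) ^ 2), ← Int.cast_sub]
    exact le_mul_of_one_le_right (by positivity) h2
  have hlne (i j : Fin N) (hij : i ≠ j) : (l i : ℂ) - l j ≠ 0 := by
    intro h
    have h1 : l i - l j = 0 := by exact_mod_cast h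
    have := hl i j hij
    rw [h1, abs_zero] at this
    exact absurd this (not_le.2 (by positivity))
  let K : Matrix (Fin N) (Fin N) ℂ := fun i j => X i j / ((l i : ℂ) - l j)
  have hY (i j : Fin N) : (K * Matrix.diagonal (fun i => ((|l i| : ℝ) : ℂ)) - Matrix.diagonal (fun i => ((|l i| : ℝ) : ℂ)) * K) i j
      = - (((|l i| - |l j|) / (l i - l j) : ℝ) : ℂ) * X i j := by
    rw [Matrix.sub_apply, Matrix.mul_diagonal, Matrix.diagonal_mul]
    simp only [K]
    push_cast
    ring
  refine ⟨K, l, ?_, ?_, ?_, ?_, ?_⟩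
  · ext i j
    rw [Matrix.star_apply]
    have h1 := congrFun (congrFun hXs i) j
    rw [Matrix.star_apply, Matrix.neg_apply] at h1
    simp only [K, Complex.star_def, map_div₀, map_sub, Complex.conj_ofReal] at h1 ⊢
    rw [h1, ← neg_sub (l i : ℂ), neg_div_neg_eq]
  · have h1 := norm_le_of_entry_le K (1 / (N : ℝ) ^ 2) fun i j => by
      by_cases hij : i = j
      · subst hij; simp [K]
      · simp only [K]
        rw [norm_div, ← Complex.ofReal_sub, Complex.norm_real, Real.norm_eq_abs]
        exact div_le_div₀ zero_le_one ((norm_entry_le X i j).trans hX1) (by positivity) (hl i j hij)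
    rwa [mul_one_div_cancel (by positivity)] at h1
  · intro i
    rw [hla]
    have h1 : (N : ℝ) ≤ 2 ^ N := by exact_mod_cast Nat.lt_two_pow_self.le
    have h2 : (2 : ℝ) ^ (i : ℕ) ≤ 2 ^ N := pow_le_pow_right₀ (by norm_num) i.2.le
    calc (N : ℝ) ^ 2 * 2 ^ (i : ℕ) ≤ (2 ^ N) ^ 2 * 2 ^ N := by gcongr
      _ = 8 ^ N := by rw [← pow_succ, ← pow_mul, mul_comm, pow_mul]; norm_num
  · have h1 : K * Matrix.diagonal (fun i => (l i : ℂ)) - Matrix.diagonal (fun i => (l i : ℂ)) * K = -X := by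
      ext i j
      rw [Matrix.sub_apply, Matrix.mul_diagonal, Matrix.diagonal_mul, Matrix.neg_apply]
      simp only [K]
      by_cases hij : i = j
      · subst hij; simp [hXd]
      · have := hlne i j hij
        field_simp
        ring
    rw [h1, norm_neg]
    exact hX1
  · have hb (a : Fin p) : 2 * (a : ℕ) < N := by have := a.2; omega
    have hb' (a : Fin p) : 2 * (a : ℕ) + 1 < N := by have := a.2; omega
    have h1 := norm_sum_entries_le (K * Matrix.diagonal (fun i => ((|l i| : ℝ) : ℂ)) - Matrix.diagonal (fun i => ((|l i| : ℝ) : ℂ)) * K)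
      (fun a : Fin p => ⟨2 * a, hb a⟩) (fun a : Fin p => ⟨2 * a + 1, hb' a⟩)
      (fun a b h => by simpa [Fin.ext_iff] using h) (fun a b h => by simpa [Fin.ext_iff] using h)
    have hterm (a b : Fin p) : 1 / 15 * (1 / |((2 * a : ℕ) : ℝ) - ((2 * b + 1 : ℕ) : ℝ)|) ≤
        ((((|l ⟨2 * a, hb a⟩| - |l ⟨2 * b + 1, hb' b⟩|) /
          (l ⟨2 * a, hb a⟩ - l ⟨2 * b + 1, hb' b⟩) : ℝ) : ℂ) * X ⟨2 * a, hb a⟩ ⟨2 * b + 1, hb' b⟩).re := by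
      have hne : 2 * (a : ℕ) ≠ 2 * b + 1 := by omega
      rw [hX _ _ (by simpa [Fin.ext_iff] using hne), Complex.re_ofReal_mul, re_symbol]
      have h2 : (|l ⟨2 * a, hb a⟩| - |l ⟨2 * b + 1, hb' b⟩|) / (l ⟨2 * a, hb a⟩ - l ⟨2 * b + 1, hb' b⟩)
          = ((2:ℝ) ^ (2 * (a : ℕ)) - 2 ^ (2 * (b : ℕ) + 1)) / (2 ^ (2 * (a : ℕ)) + 2 ^ (2 * (b : ℕ) + 1)) := by
        rw [hla, hla, ← mul_sub]
        simp only [l]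
        rw [← mul_sub, mul_div_mul_left _ _ (by positivity)]
        congr 1
        push_cast
        rw [(even_two_mul (a : ℕ)).neg_pow, (odd_two_mul_add_one (b : ℕ)).neg_pow, sub_neg_eq_add]
      rw [h2, one_div_mul_one_div]
      refine ratio_mul_symbol_lower N hne ?_
      have ha := a.2
      have hbb := b.2
      have ha' : (a : ℝ) + 1 ≤ p := by exact_mod_cast ha
      have hbb' : (b : ℝ) + 1 ≤ p := by exact_mod_cast hbb
      have : (0:ℝ) ≤ (a : ℕ) := by positivity
      have : (0:ℝ) ≤ (b : ℕ) := by positivity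
      rw [hN]
      push_cast
      have : |2 * (a : ℝ) - (2 * b + 1)| ≤ 2 * p := by rw [abs_le]; constructor <;> linarith
      linarith
    have h3 : (p : ℝ) * (Real.log (p + 1) / 30) ≤
        (- ∑ a : Fin p, ∑ b : Fin p, (K * Matrix.diagonal (fun i => ((|l i| : ℝ) : ℂ)) -
          Matrix.diagonal (fun i => ((|l i| : ℝ) : ℂ)) * K) ⟨2 * a, hb a⟩ ⟨2 * b + 1, hb' b⟩).re := by
      simp only [hY, neg_mul, Finset.sum_neg_distrib, neg_neg, Complex.re_sum]
      calc (p : ℝ) * (Real.log (p + 1) / 30) = ∑ a : Fin p, Real.log (p + 1) / 30 := by simp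
        _ ≤ ∑ a : Fin p, ∑ b : Fin p, 1 / 15 * (1 / |((2 * a : ℕ) : ℝ) - ((2 * b + 1 : ℕ) : ℝ)|) := by
          refine Finset.sum_le_sum fun a _ => ?_
          rw [← Finset.mul_sum, Fin.sum_univ_eq_sum_range
            (fun b => 1 / |((2 * (a : ℕ) : ℕ) : ℝ) - ((2 * b + 1 : ℕ) : ℝ)|)]
          linarith [log_le_row_sum p a a.2.le]
        _ ≤ _ := Finset.sum_le_sum fun a _ => Finset.sum_le_sum fun b _ => hterm a b
    have h4 := (h3.trans (Complex.re_le_norm _)).trans ((norm_neg _).le.trans h1)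
    exact le_of_mul_le_mul_left h4 (by exact_mod_cast hp)

theorem opAbs_eq {H : Type} [NormedAddCommGroup H] [InnerProductSpace ℂ H]
    [CompleteSpace H] {T S : H →L[ℂ] H} (hS : 0 ≤ S) (h : S * S = star T * T) : opAbs T = S := by
  have hsa : IsSelfAdjoint S := .of_nonneg hS
  have hsq : cfc (fun x : ℝ => x * x) S = S * S := by
    rw [cfc_mul (fun x : ℝ => x) (fun x : ℝ => x) S, cfc_id' ℝ S]
  rw [opAbs, ← h, ← hsq, ← cfc_comp' Real.sqrt (fun x : ℝ => x * x) S]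
  refine (cfc_congr fun x hx => ?_).trans (cfc_id' ℝ S)
  exact Real.sqrt_mul_self (spectrum_nonneg_of_nonneg hS hx)

theorem exists_isometric_embedding (N : ℕ) : ∃ φ : Matrix (Fin N) (Fin N) ℂ → (ellTwo →L[ℂ] ellTwo),
    (∀ x y, φ (x - y) = φ x - φ y) ∧ (∀ x y, φ (x * y) = φ x * φ y) ∧
    (∀ x, φ (star x) = star (φ x)) ∧ ∀ x, ‖φ x‖ = ‖x‖ := by
  let b : HilbertBasis ℕ ℂ ellTwo := ⟨LinearIsometryEquiv.refl ℂ _⟩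
  let e := (EuclideanSpace.basisFun (Fin N) ℂ)
  have hb : Orthonormal ℂ (fun i : Fin N => b i) := b.orthonormal.comp _ Fin.val_injective
  let V : EuclideanSpace ℂ (Fin N) →ₗᵢ[ℂ] ellTwo :=
    (e.toBasis.constr ℂ (fun i : Fin N => b i)).isometryOfOrthonormal (v := e.toBasis)
      (by simp [e.orthonormal])
      (by convert hb using 1; exact funext fun i => e.toBasis.constr_basis ℂ _ i)
  let W := V.toContinuousLinearMap
  have hW : (ContinuousLinearMap.adjoint W) ∘L W = 1 :=
    (ContinuousLinearMap.norm_map_iff_adjoint_comp_self W).1 V.norm_map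
  have hW' (x) : ContinuousLinearMap.adjoint W (W x) = x := DFunLike.congr_fun hW x
  have hWn : ‖W‖ ≤ 1 := V.norm_toContinuousLinearMap_le
  have hWn' : ‖ContinuousLinearMap.adjoint W‖ ≤ 1 := by rwa [LinearIsometryEquiv.norm_map]
  let Φ := Matrix.toEuclideanCLM (n := Fin N) (𝕜 := ℂ)
  refine ⟨fun x => W ∘L Φ x ∘L ContinuousLinearMap.adjoint W, ?_, ?_, ?_, ?_⟩
  · intro x y; ext1 z; simp
  · intro x y; ext1 z; simp [hW']
  · intro x
    simp only [map_star, ContinuousLinearMap.star_eq_adjoint, ContinuousLinearMap.adjoint_comp,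
      ContinuousLinearMap.adjoint_adjoint]
    rfl
  · intro x
    rw [← Matrix.l2_opNorm_toEuclideanCLM x]
    refine le_antisymm ?_ ?_
    · refine (ContinuousLinearMap.opNorm_comp_le _ _).trans ?_
      refine (mul_le_of_le_one_left (norm_nonneg _) hWn).trans ?_
      refine (ContinuousLinearMap.opNorm_comp_le _ _).trans ?_
      exact mul_le_of_le_one_right (norm_nonneg _) hWn'
    · have h1 : Φ x = ContinuousLinearMap.adjoint W ∘L ((W ∘L Φ x ∘L ContinuousLinearMap.adjoint W) ∘L W) := by
        ext1 z; simp [hW']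
      change ‖Φ x‖ ≤ _
      refine (congrArg norm h1).le.trans ?_
      refine (ContinuousLinearMap.opNorm_comp_le _ _).trans ?_
      refine (mul_le_of_le_one_left (norm_nonneg _) hWn').trans ?_
      refine (ContinuousLinearMap.opNorm_comp_le _ _).trans ?_
      exact mul_le_of_le_one_right (norm_nonneg _) hWn

theorem exists_opAbs_sub_lower_bound (p : ℕ) (hp : 0 < p) (s : ℝ) (hs : 0 ≤ s) : ∃ A B : ellTwo →L[ℂ] ellTwo,
    IsSelfAdjoint A ∧ IsSelfAdjoint B ∧ ‖A‖ ≤ s * 8 ^ (8 * p) ∧ ‖B‖ ≤ s * 8 ^ (8 * p) ∧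
    ‖A - B‖ ≤ 2 * s ∧ s * Real.log (p + 1) / 60 ≤ ‖opAbs A - opAbs B‖ := by
  obtain ⟨K, l, hK, hK1, hl, hKl, hKa⟩ := exists_commutator_lower_bound p hp
  obtain ⟨U, hU, hUb⟩ := exists_unitary_norm_sub_conj K hK hK1
  obtain ⟨φ, hsub, hmul, hstar, hnorm⟩ := exists_isometric_embedding (8 * p)
  set Λ := Matrix.diagonal (fun i => (l i : ℂ)) with hΛ
  set P := Matrix.diagonal (fun i => ((|l i| : ℝ) : ℂ)) with hP
  set S := Matrix.diagonal (fun i => ((√(s * |l i|) : ℝ) : ℂ)) with hS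
  have hsΛ : star ((s : ℂ) • Λ) = (s : ℂ) • Λ := by
    rw [star_smul, hΛ, Matrix.star_eq_conjTranspose, Matrix.diagonal_conjTranspose]
    simp [Pi.star_def]
  have hsS : star S = S := by
    rw [hS, Matrix.star_eq_conjTranspose, Matrix.diagonal_conjTranspose]
    simp [Pi.star_def]
  have hSS : S * S = (s : ℂ) • P := by
    rw [hS, hP, Matrix.diagonal_mul_diagonal, ← Matrix.diagonal_smul]
    congr 1; ext i
    rw [← Complex.ofReal_mul, Real.mul_self_sqrt (by positivity)]
    simp
  have hPP : ((s : ℂ) • P) * ((s : ℂ) • P) = ((s : ℂ) • Λ) * ((s : ℂ) • Λ) := by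
    simp only [smul_mul_smul_comm]
    rw [hΛ, hP, Matrix.diagonal_mul_diagonal, Matrix.diagonal_mul_diagonal]
    congr 2; ext i
    rw [← Complex.ofReal_mul, abs_mul_abs_self, Complex.ofReal_mul]
  have hUU : star U * U = 1 := (Unitary.mem_iff.1 hU).1
  have hconj (x y : Matrix (Fin (8 * p)) (Fin (8 * p)) ℂ) :
      (U * x * star U) * (U * y * star U) = U * (x * y) * star U := by
    calc (U * x * star U) * (U * y * star U) = U * x * (star U * U) * y * star U := by noncomm_ring
      _ = _ := by rw [hUU]; noncomm_ring
  have hconjs (x : Matrix (Fin (8 * p)) (Fin (8 * p)) ℂ) :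
      star (U * x * star U) = U * star x * star U := by
    simp [mul_assoc]
  have hn : ‖(s : ℂ) • Λ‖ ≤ s * 8 ^ (8 * p) := by
    rw [norm_smul, Complex.norm_real, Real.norm_of_nonneg hs, hΛ, Matrix.l2_opNorm_diagonal]
    gcongr
    rw [pi_norm_le_iff_of_nonneg (by positivity)]
    intro i
    rw [Complex.norm_real]
    exact hl i
  have habs1 : opAbs (φ ((s : ℂ) • Λ)) = φ ((s : ℂ) • P) := by
    refine opAbs_eq ?_ ?_
    · rw [← hSS]
      nth_rw 1 [← hsS]
      rw [hmul, hstar]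
      exact star_mul_self_nonneg _
    · rw [← hstar, ← hmul, ← hmul, hPP, hsΛ]
  have habs2 : opAbs (φ (U * ((s : ℂ) • Λ) * star U)) = φ (U * ((s : ℂ) • P) * star U) := by
    refine opAbs_eq ?_ ?_
    · rw [← hSS, ← hconj]
      nth_rw 1 [← hsS]
      rw [← hconjs, hmul, hstar]
      exact star_mul_self_nonneg _
    · rw [← hstar, ← hmul, ← hmul, hconjs, hconj, hconj, hPP, hsΛ]
  have hcomm (x : Matrix (Fin (8 * p)) (Fin (8 * p)) ℂ) :
      ‖K * ((s : ℂ) • x) - ((s : ℂ) • x) * K‖ = s * ‖K * x - x * K‖ := by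
    rw [mul_smul_comm, smul_mul_assoc, ← smul_sub, norm_smul, Complex.norm_real, Real.norm_of_nonneg hs]
  refine ⟨φ ((s : ℂ) • Λ), φ (U * ((s : ℂ) • Λ) * star U), ?_, ?_, ?_, ?_, ?_, ?_⟩
  · rw [IsSelfAdjoint, ← hstar, hsΛ]
  · rw [IsSelfAdjoint, ← hstar, hconjs, hsΛ]
  · rw [hnorm]; exact hn
  · rw [hnorm, CStarRing.norm_mul_mem_unitary _ (Unitary.star_mem hU), CStarRing.norm_mem_unitary_mul _ hU]
    exact hn
  · rw [← hsub, hnorm]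
    have h1 := (hUb ((s : ℂ) • Λ)).1
    rw [hcomm] at h1
    nlinarith
  · rw [habs1, habs2, ← hsub, hnorm]
    have h1 := (hUb ((s : ℂ) • P)).2
    rw [hcomm] at h1
    have h2 := mul_le_mul_of_nonneg_left hKa hs
    linarith

theorem spectrum_subset_Icc {A : ellTwo →L[ℂ] ellTwo} {a : ℝ} (h : ‖A‖ ≤ a) :
    spectrum ℝ A ⊆ Set.Icc (-a) a := by
  intro x hx
  rw [← spectrum.algebraMap_mem_iff ℂ] at hx
  have h1 := spectrum.norm_le_norm_mul_of_mem hx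
  have h2 : ‖(1 : ellTwo →L[ℂ] ellTwo)‖ ≤ 1 := ContinuousLinearMap.norm_id_le
  have h3 : |x| ≤ a := by
    have h4 : ‖(algebraMap ℝ ℂ) x‖ = |x| := by simp
    rw [h4] at h1
    exact (h1.trans (mul_le_of_le_one_right (norm_nonneg _) h2)).trans h
  exact abs_le.1 h3

theorem stmt2 :
    ∃ c : ℝ, 0 < c ∧
      ∀ a δ : ℝ, 0 < a → 0 < δ → δ < a →
        ∃ A B : ellTwo →L[ℂ] ellTwo,
          IsSelfAdjoint A ∧ IsSelfAdjoint B ∧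
          spectrum ℝ A ⊆ Set.Icc (-a) a ∧ spectrum ℝ B ⊆ Set.Icc (-a) a ∧
          0 < ‖A - B‖ ∧ ‖A - B‖ ≤ δ ∧
          c * δ * Real.log (2 + Real.log (a / δ)) ≤ ‖opAbs A - opAbs B‖ := by
  refine ⟨1 / 480, by norm_num, fun a δ ha hδ hδa => ?_⟩
  have hL : 0 < Real.log (a / δ) := Real.log_pos (by rwa [one_lt_div hδ])
  set L := Real.log (a / δ) with hLdef
  rcases lt_or_ge L 96 with h | h
  · have : Nontrivial ellTwo := by
      let b : HilbertBasis ℕ ℂ ellTwo := ⟨LinearIsometryEquiv.refl ℂ _⟩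
      exact ⟨b 0, 0, b.orthonormal.ne_zero 0⟩
    have h1 : ‖(1 : ellTwo →L[ℂ] ellTwo)‖ = 1 := norm_one
    have hn : ‖(δ : ℂ) • (1 : ellTwo →L[ℂ] ellTwo)‖ = δ := by
      rw [norm_smul, h1, Complex.norm_real, Real.norm_of_nonneg hδ.le, mul_one]
    have hs : IsSelfAdjoint ((δ : ℂ) • (1 : ellTwo →L[ℂ] ellTwo)) := by
      rw [IsSelfAdjoint, star_smul, star_one]; simp
    have e0 : opAbs (0 : ellTwo →L[ℂ] ellTwo) = 0 := opAbs_eq le_rfl (by simp)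
    have e1 : opAbs ((δ : ℂ) • (1 : ellTwo →L[ℂ] ellTwo)) = (δ : ℂ) • (1 : ellTwo →L[ℂ] ellTwo) := by
      refine opAbs_eq ?_ (by rw [hs.star_eq])
      have hsq : (δ : ℂ) • (1 : ellTwo →L[ℂ] ellTwo) =
          star (((√δ : ℝ) : ℂ) • (1 : ellTwo →L[ℂ] ellTwo)) * (((√δ : ℝ) : ℂ) • 1) := by
        rw [star_smul, star_one, smul_mul_smul_comm, one_mul, Complex.star_def, Complex.conj_ofReal,
          ← Complex.ofReal_mul, Real.mul_self_sqrt hδ.le]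
      rw [hsq]
      exact star_mul_self_nonneg _
    refine ⟨(δ : ℂ) • 1, 0, hs, .zero _, spectrum_subset_Icc (hn.le.trans hδa.le),
      spectrum_subset_Icc (by simpa using ha.le), ?_, ?_, ?_⟩
    · rw [sub_zero, hn]; exact hδ
    · rw [sub_zero, hn]
    · rw [e0, e1, sub_zero, hn]
      have := Real.log_le_self (x := 2 + L) (by linarith)
      nlinarith
  · set p := ⌊L / 24⌋₊ with hp
    have hp4 : 4 ≤ p := Nat.le_floor (by norm_num; linarith)
    have hp4' : (4 : ℝ) ≤ p := by exact_mod_cast hp4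
    have hpL : (p : ℝ) ≤ L / 24 := Nat.floor_le (by positivity)
    have hpL' : L / 24 < p + 1 := Nat.lt_floor_add_one _
    have h8 : (8 : ℝ) ^ (8 * p) ≤ a / δ := by
      have h1 : (8 : ℝ) ^ (8 * p) = 2 ^ (24 * p) := by
        rw [show (8 : ℝ) = 2 ^ 3 by norm_num, ← pow_mul]; congr 1; ring
      have h2 : (2 : ℝ) ≤ Real.exp 1 := by linarith [Real.add_one_le_exp (1 : ℝ)]
      rw [h1]
      calc (2 : ℝ) ^ (24 * p) ≤ Real.exp 1 ^ (24 * p) := by gcongr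
        _ = Real.exp (24 * p) := by rw [← Real.exp_nat_mul]; push_cast; ring_nf
        _ ≤ Real.exp L := by rw [Real.exp_le_exp]; linarith
        _ = a / δ := Real.exp_log (by positivity)
    have hlog : Real.log (2 + L) ≤ 4 * Real.log (p + 1) := by
      have h1 : 2 + L ≤ ((p : ℝ) + 1) ^ 4 := by nlinarith [sq_nonneg ((p : ℝ) ^ 2)]
      have := Real.log_le_log (by linarith) h1
      rwa [Real.log_pow] at this
    obtain ⟨A, B, hA, hB, hAn, hBn, hAB, hlow⟩ := exists_opAbs_sub_lower_bound p (by omega) (δ / 2) (by positivity)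
    have hsz : δ / 2 * 8 ^ (8 * p) ≤ a := by
      rw [le_div_iff₀ hδ] at h8
      nlinarith
    have hfin : 1 / 480 * δ * Real.log (2 + L) ≤ ‖opAbs A - opAbs B‖ := by
      have := mul_le_mul_of_nonneg_left hlog hδ.le
      linarith
    refine ⟨A, B, hA, hB, spectrum_subset_Icc (hAn.trans hsz), spectrum_subset_Icc (hBn.trans hsz), ?_,
      by linarith, hfin⟩
    rw [norm_pos_iff, sub_ne_zero]
    rintro rfl
    have : 0 < Real.log (2 + L) := Real.log_pos (by linarith)
    rw [sub_self, norm_zero] at hfin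
    exact absurd hfin (not_le.2 (by positivity))
end
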